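/- arXiv:2301.07063 — 4 statements merged into one kernel-verified Lean document; each statement's English description precedes it below -/
import Mathlib

section
/- We have 𝔠₂ ≤ C·δ^{−2}·L^{3d−4γ} if γ ≤ 1/2, and 𝔠₂ ≤ C·δ^{−2}·L^{3(d−γ)−γ₀−10η} if γ > 1/2; in particular, in all cases 𝔠₂ ≤ C·δ^{−2}·L^{3(d−γ)−γ₀}. -/
open scoped RealInnerProductSpace BigOperators

noncomputable section

/-- The rescaled lattice `ℤ_L^d = (L⁻¹ℤ)^d` inside `ℝ^d`. -/
def ZLat (d : ℕ) (L : ℝ) : Set (EuclideanSpace ℝ (Fin d)) :=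
  {x | ∀ i, ∃ m : ℤ, x i = (m : ℝ) / L}

/-- The counting quantity `𝔠₂`. -/
def count2 (d : ℕ) (L δ γ α β : ℝ) (v x0 y0 z0 : EuclideanSpace ℝ (Fin d))
    (ζ : EuclideanSpace ℝ (Fin d) → EuclideanSpace ℝ (Fin d) → EuclideanSpace ℝ (Fin d) →
      EuclideanSpace ℝ (Fin d)) : ℕ :=
  Set.ncard {q : EuclideanSpace ℝ (Fin d) × EuclideanSpace ℝ (Fin d) × EuclideanSpace ℝ (Fin d) |
    q.1 ∈ ZLat d L ∧ q.2.1 ∈ ZLat d L ∧ q.2.2 ∈ ZLat d L ∧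
    ‖q.1 - x0‖ ≤ 1 ∧ ‖q.2.1 - y0‖ ≤ 1 ∧ ‖q.2.2 - z0‖ ≤ 1 ∧
    |⟪q.1, q.2.1⟫ - α| ≤ δ⁻¹ * L ^ (-(2 * γ)) ∧
    |⟪ζ q.1 q.2.1 q.2.2, q.2.2⟫ - β| ≤ δ⁻¹ * L ^ (-(2 * γ))}

/-- A set of integers of diameter at most `l`, all congruent modulo `n`. -/
theorem card_mul_le_of_dvd_sub (s : Finset ℤ) (n l : ℕ) (hn : 0 < n)
    (h : ∀ x ∈ s, ∀ y ∈ s, |x - y| ≤ l ∧ (n : ℤ) ∣ x - y) : s.card * n ≤ l + n := by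
  rcases s.eq_empty_or_nonempty with rfl | hs
  · simp
  have hm := s.min'_mem hs
  set m := s.min' hs with hmdef
  have hcard : s.card ≤ (Finset.range (l / n + 1)).card := by
    apply Finset.card_le_card_of_injOn (fun x => ((x - m) / n).toNat)
    · intro x hx
      have hx' : x ∈ s := hx
      have h1 := (h x hx' m hm).1
      have h2 : m ≤ x := s.min'_le x hx'
      rw [abs_of_nonneg (by omega)] at h1
      have h3 : (x - m) / (n : ℤ) ≤ (l : ℤ) / n :=
        Int.ediv_le_ediv (by exact_mod_cast hn) h1
      have h4 : 0 ≤ (l : ℤ) / n := by positivity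
      simp only [Finset.coe_range, Set.mem_Iio]
      omega
    · intro x hx y hy hxy
      have h1 : 0 ≤ (x - m) / (n : ℤ) :=
        Int.ediv_nonneg (by have := s.min'_le x hx; omega) (by omega)
      have h2 : 0 ≤ (y - m) / (n : ℤ) :=
        Int.ediv_nonneg (by have := s.min'_le y hy; omega) (by omega)
      have h3 : (x - m) / (n : ℤ) = (y - m) / (n : ℤ) := by
        have : ((x - m) / (n : ℤ)).toNat = ((y - m) / (n : ℤ)).toNat := hxy
        omega
      have h4 := Int.ediv_mul_cancel (h x hx m hm).2
      have h5 := Int.ediv_mul_cancel (h y hy m hm).2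
      rw [h3] at h4
      omega
  rw [Finset.card_range] at hcard
  calc s.card * n ≤ (l / n + 1) * n := Nat.mul_le_mul_right _ hcard
    _ = l / n * n + n := by ring
    _ ≤ l + n := by gcongr; exact Nat.div_mul_le_self l n

/-- Lattice points of a planar box on which the linear form `(a, b)` varies by at most `l`. -/
theorem card_mul_natAbs_le (s : Finset (ℤ × ℤ)) (a b : ℤ) (l K : ℕ) (ha : a ≠ 0)
    (haK : a.natAbs ≤ K)
    (h1 : ∀ u ∈ s, ∀ v ∈ s, |u.2 - v.2| ≤ (2 * K : ℕ))
    (h2 : ∀ u ∈ s, ∀ v ∈ s, |(a * u.1 + b * u.2) - (a * v.1 + b * v.2)| ≤ l) :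
    s.card * a.natAbs ≤ (3 * K) * (l + Int.gcd a b) := by
  set g := Int.gcd a b with hg
  have hgpos : 0 < g := Int.gcd_pos_of_ne_zero_left b ha
  obtain ⟨c, hc⟩ : g ∣ a.natAbs := by
    rw [hg]; exact Nat.gcd_dvd_left _ _
  have hcpos : 0 < c := by
    rcases Nat.eq_zero_or_pos c with h | h
    · subst h; simp at hc; exact absurd hc ha
    · exact h
  have hcK : c ≤ K := by
    refine le_trans ?_ haK
    rw [hc]; exact Nat.le_mul_of_pos_left c hgpos
  let f : ℤ × ℤ → ℤ := fun u => a * u.1 + b * u.2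
  have hn1 : (s.image f).card * g ≤ l + g := by
    apply card_mul_le_of_dvd_sub _ _ _ hgpos
    intro x hx y hy
    obtain ⟨u, hu, rfl⟩ := Finset.mem_image.1 hx
    obtain ⟨v, hv, rfl⟩ := Finset.mem_image.1 hy
    refine ⟨h2 u hu v hv, ?_⟩
    have ha' : (g : ℤ) ∣ a := Int.gcd_dvd_left _ _
    have hb' : (g : ℤ) ∣ b := Int.gcd_dvd_right _ _
    exact dvd_sub (dvd_add (ha'.mul_right _) (hb'.mul_right _))
      (dvd_add (ha'.mul_right _) (hb'.mul_right _))
  have hfib : ∀ m ∈ s.image f, (s.filter (fun x => f x = m)).card ≤ 3 * K / c := by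
    intro m _
    rw [Nat.le_div_iff_mul_le hcpos]
    have hinj : Set.InjOn (fun u : ℤ × ℤ => u.2) (s.filter (fun x => f x = m)) := by
      intro u hu v hv huv
      simp only [Finset.coe_filter, Set.mem_ofPred_eq, f] at hu hv
      have huv' : u.2 = v.2 := huv
      have : a * u.1 = a * v.1 := by have := hu.2.trans hv.2.symm; rw [huv'] at this; linarith
      exact Prod.ext (mul_left_cancel₀ ha this) huv'
    rw [← Finset.card_image_of_injOn hinj]
    refine (card_mul_le_of_dvd_sub _ c (2 * K) hcpos ?_).trans (by omega)
    intro x hx y hy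
    obtain ⟨u, hu, rfl⟩ := Finset.mem_image.1 hx
    obtain ⟨v, hv, rfl⟩ := Finset.mem_image.1 hy
    simp only [Finset.mem_filter, f] at hu hv
    refine ⟨h1 u hu.1 v hv.1, ?_⟩
    have e : a * (v.1 - u.1) = b * (u.2 - v.2) := by
      have := hu.2.trans hv.2.symm; linarith
    have hcop := Int.isCoprime_iff_gcd_eq_one.2 (Int.gcd_div_gcd_div_gcd (i := a) (j := b) hgpos)
    have ea : a = g * (a / g) := (Int.mul_ediv_cancel' (Int.gcd_dvd_left _ _)).symm
    have eb : b = g * (b / g) := (Int.mul_ediv_cancel' (Int.gcd_dvd_right _ _)).symm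
    have hg0 : (g : ℤ) ≠ 0 := by exact_mod_cast hgpos.ne'
    have hdvd : a / g ∣ (b / g) * (u.2 - v.2) := by
      refine ⟨v.1 - u.1, ?_⟩
      apply mul_left_cancel₀ hg0
      rw [← mul_assoc, ← mul_assoc, ← ea, ← eb, e]
    have h3 := hcop.dvd_of_dvd_mul_left hdvd
    have hc' : (a / g).natAbs = c := by
      have : a.natAbs = g * (a / g).natAbs := by
        conv_lhs => rw [ea]
        simp [Int.natAbs_mul]
      exact Nat.eq_of_mul_eq_mul_left hgpos (this.symm.trans hc)
    rw [← hc']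
    exact Int.natAbs_dvd.2 h3
  have hs := Finset.card_le_mul_card_image s (3 * K / c) hfib
  calc s.card * a.natAbs = s.card * (g * c) := by rw [hc]
    _ ≤ (3 * K / c * (s.image f).card) * (g * c) := Nat.mul_le_mul_right _ hs
    _ = (3 * K / c * c) * ((s.image f).card * g) := by ring
    _ ≤ (3 * K) * (l + g) := Nat.mul_le_mul (Nat.div_mul_le_self _ _) hn1

/-- The integer points of the sup-norm ball of radius `K`. -/
def intBox (d K : ℕ) : Finset (Fin d → ℤ) :=
  Fintype.piFinset fun _ => Finset.Icc (-(K : ℤ)) K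

theorem mem_intBox {d K : ℕ} {P : Fin d → ℤ} : P ∈ intBox d K ↔ ∀ i, |P i| ≤ K := by
  simp [intBox, abs_le]

theorem card_intBox (d K : ℕ) : (intBox d K).card = (2 * K + 1) ^ d := by
  simp only [intBox, Fintype.card_piFinset, Int.card_Icc, Finset.prod_const, Finset.card_univ,
    Fintype.card_fin]
  congr 1
  omega

/-- The points of the box of radius `K` almost orthogonal to `P`. -/
def nearOrth (d K T : ℕ) (P : Fin d → ℤ) : Finset (Fin d → ℤ) :=
  (intBox d K).filter fun Q => |P ⬝ᵥ Q| ≤ T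

theorem prod_ite_two_eq {d : ℕ} {i j : Fin d} (hij : i ≠ j) (A B : ℕ) :
    ∏ k, (if k = i then A else if k = j then A else B) = A ^ 2 * B ^ (d - 2) := by
  rw [← Finset.mul_prod_erase Finset.univ _ (Finset.mem_univ i),
    ← Finset.mul_prod_erase (Finset.univ.erase i) _ (Finset.mem_erase.2 ⟨hij.symm, Finset.mem_univ j⟩)]
  rw [Finset.prod_congr rfl (g := fun _ => B)]
  · simp [hij.symm, Finset.card_erase_of_mem, sq, mul_assoc, Nat.sub_sub]
  · intro k hk
    simp only [Finset.mem_erase] at hk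
    simp [hk.1, hk.2.1]

theorem card_nearOrth_mul_le {d K T : ℕ} {P : Fin d → ℤ} {i j : Fin d}
    (hij : i ≠ j) (hi : P i ≠ 0) (hK : (P i).natAbs ≤ K) :
    (nearOrth d K T P).card * (P i).natAbs ≤
      (2 * K + 1) ^ (d - 2) * ((3 * K) * (2 * T + Int.gcd (P i) (P j))) := by
  let f : (Fin d → ℤ) → (Fin d → ℤ) := fun Q k => if k = i then 0 else if k = j then 0 else Q k
  let t : Finset (Fin d → ℤ) := Fintype.piFinset fun k =>
    if k = i then {0} else if k = j then {0} else Finset.Icc (-(K : ℤ)) K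
  have ht : t.card = (2 * K + 1) ^ (d - 2) := by
    rw [Fintype.card_piFinset]
    rw [Finset.prod_congr rfl (g := fun k => if k = i then 1 else if k = j then 1 else 2 * K + 1)]
    · rw [prod_ite_two_eq hij]; simp
    · intro k _
      split_ifs
      · simp
      · simp
      · rw [Int.card_Icc]; omega
  have hmaps : ∀ Q ∈ nearOrth d K T P, f Q ∈ t := by
    intro Q hQ
    have hQ := mem_intBox.1 (Finset.mem_filter.1 hQ).1
    simp only [t, f, Fintype.mem_piFinset]
    intro k
    have := abs_le.1 (hQ k)
    split_ifs <;> simp [this.1, this.2]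
  have ha : 0 < (P i).natAbs := Int.natAbs_pos.2 hi
  have hfib : ∀ R ∈ t, ((nearOrth d K T P).filter (fun Q => f Q = R)).card ≤
      ((3 * K) * (2 * T + Int.gcd (P i) (P j))) / (P i).natAbs := by
    intro R _
    rw [Nat.le_div_iff_mul_le ha]
    set s := (nearOrth d K T P).filter (fun Q => f Q = R)
    have hs : ∀ Q ∈ s, (∀ k, |Q k| ≤ K) ∧ |P ⬝ᵥ Q| ≤ T ∧ f Q = R := by
      intro Q hQ
      simp only [s, nearOrth, Finset.mem_filter, mem_intBox] at hQ
      tauto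
    have heq : ∀ Q ∈ s, ∀ Q' ∈ s, ∀ k, k ≠ i → k ≠ j → Q k = Q' k := by
      intro Q hQ Q' hQ' k hki hkj
      have := congrFun ((hs Q hQ).2.2.trans (hs Q' hQ').2.2.symm) k
      simpa [f, hki, hkj] using this
    have hinj : Set.InjOn (fun Q : Fin d → ℤ => (Q i, Q j)) s := by
      intro Q hQ Q' hQ' h
      simp only [Prod.mk.injEq] at h
      funext k
      by_cases hki : k = i
      · subst hki; exact h.1
      by_cases hkj : k = j
      · subst hkj; exact h.2
      exact heq Q hQ Q' hQ' k hki hkj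
    rw [← Finset.card_image_of_injOn hinj]
    apply card_mul_natAbs_le _ _ _ _ _ hi hK
    · intro u hu v hv
      obtain ⟨Q, hQ, rfl⟩ := Finset.mem_image.1 hu
      obtain ⟨Q', hQ', rfl⟩ := Finset.mem_image.1 hv
      have h1 := abs_le.1 ((hs Q hQ).1 j)
      have h2 := abs_le.1 ((hs Q' hQ').1 j)
      rw [abs_le]
      push_cast
      constructor <;> linarith
    · intro u hu v hv
      obtain ⟨Q, hQ, rfl⟩ := Finset.mem_image.1 hu
      obtain ⟨Q', hQ', rfl⟩ := Finset.mem_image.1 hv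
      have e : P i * Q i + P j * Q j - (P i * Q' i + P j * Q' j) = P ⬝ᵥ Q - P ⬝ᵥ Q' := by
        rw [← dotProduct_sub, dotProduct]
        rw [← Finset.add_sum_erase Finset.univ _ (Finset.mem_univ i),
          ← Finset.add_sum_erase (Finset.univ.erase i) _
            (Finset.mem_erase.2 ⟨hij.symm, Finset.mem_univ j⟩), Finset.sum_eq_zero]
        · simp only [Pi.sub_apply]; ring
        · intro k hk
          simp only [Finset.mem_erase] at hk
          simp [heq Q hQ Q' hQ' k hk.2.1 hk.1]
      have h1 := abs_le.1 (hs Q hQ).2.1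
      have h2 := abs_le.1 (hs Q' hQ').2.1
      simp only [e]
      rw [abs_le]
      push_cast
      constructor <;> linarith
  have h := Finset.card_le_mul_card_image_of_maps_to hmaps _ hfib
  rw [ht] at h
  calc _ ≤ _ := Nat.mul_le_mul_right _ h
    _ = (2 * K + 1) ^ (d - 2) *
        (((3 * K) * (2 * T + Int.gcd (P i) (P j))) / (P i).natAbs * (P i).natAbs) := by ring
    _ ≤ _ := Nat.mul_le_mul_left _ (Nat.div_mul_le_self _ _)

theorem sum_Icc_inv_sq_le_two (K : ℕ) : ∑ a ∈ Finset.Icc 1 K, ((a : ℝ) ^ 2)⁻¹ ≤ 2 := by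
  have h := sum_Ioo_inv_sq_le (α := ℝ) 0 (K + 1)
  have e : Finset.Ioo 0 (K + 1) = Finset.Icc 1 K := by
    ext x; simp; omega
  rw [e] at h
  simpa using h

theorem sum_gcd_sq_div_sq_le (K : ℕ) :
    ∑ a ∈ Finset.Icc 1 K, ∑ b ∈ Finset.range (a + 1), ((Nat.gcd a b : ℝ) ^ 2 / (a : ℝ) ^ 2)
      ≤ 4 * K := by
  let V : Finset (Σ _ : ℕ, ℕ × ℕ) :=
    (Finset.Icc 1 K).sigma fun a => Finset.Icc 1 (K / a) ×ˢ Finset.range (a + 1)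
  let e : (Σ _ : ℕ, ℕ) → (Σ _ : ℕ, ℕ × ℕ) :=
    fun u => ⟨u.1 / Nat.gcd u.1 u.2, (Nat.gcd u.1 u.2, u.2 / Nat.gcd u.1 u.2)⟩
  rw [Finset.sum_sigma']
  set U := (Finset.Icc 1 K).sigma fun a => Finset.range (a + 1) with hU
  have hmem : ∀ u ∈ U, 1 ≤ u.1 ∧ u.1 ≤ K ∧ u.2 ≤ u.1 := by
    intro u hu
    simp only [hU, Finset.mem_sigma, Finset.mem_Icc, Finset.mem_range] at hu
    omega
  have hinj : Set.InjOn e U := by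
    rintro ⟨a, b⟩ - ⟨a', b'⟩ - h
    simp only [e, Sigma.mk.injEq, heq_eq_eq, Prod.mk.injEq] at h
    obtain ⟨h1, h2, h3⟩ := h
    have e1 := Nat.div_mul_cancel (Nat.gcd_dvd_left a b)
    have e2 := Nat.div_mul_cancel (Nat.gcd_dvd_right a b)
    rw [h1, h2, Nat.div_mul_cancel (Nat.gcd_dvd_left a' b')] at e1
    rw [h3, h2, Nat.div_mul_cancel (Nat.gcd_dvd_right a' b')] at e2
    rw [e1, e2]
  have hsub : U.image e ⊆ V := by
    intro x hx
    obtain ⟨⟨a, b⟩, hu, rfl⟩ := Finset.mem_image.1 hx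
    obtain ⟨h1, h2, h3⟩ := hmem _ hu
    simp only at h1 h2 h3
    have hg : 0 < Nat.gcd a b := Nat.gcd_pos_of_pos_left _ h1
    have hq : 0 < a / Nat.gcd a b := Nat.div_pos (Nat.gcd_le_left _ h1) hg
    simp only [V, e, Finset.mem_sigma, Finset.mem_product, Finset.mem_Icc, Finset.mem_range]
    refine ⟨⟨hq, (Nat.div_le_self _ _).trans h2⟩, ⟨hg, ?_⟩,
      Nat.lt_succ_of_le (Nat.div_le_div_right h3)⟩
    rw [Nat.le_div_iff_mul_le hq, Nat.mul_div_cancel' (Nat.gcd_dvd_left a b)]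
    exact h2
  calc ∑ u ∈ U, ((Nat.gcd u.1 u.2 : ℝ) ^ 2 / (u.1 : ℝ) ^ 2)
      = ∑ u ∈ U, (((e u).1 : ℝ) ^ 2)⁻¹ := by
        refine Finset.sum_congr rfl fun u hu => ?_
        have h1 := (hmem u hu).1
        have hg : 0 < Nat.gcd u.1 u.2 := Nat.gcd_pos_of_pos_left _ h1
        have hg' : (Nat.gcd u.1 u.2 : ℝ) ≠ 0 := by exact_mod_cast hg.ne'
        simp only [e]
        rw [Nat.cast_div (Nat.gcd_dvd_left _ _) hg', div_pow, inv_div]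
    _ = ∑ x ∈ U.image e, ((x.1 : ℝ) ^ 2)⁻¹ := (Finset.sum_image
          (f := fun x : (Σ _ : ℕ, ℕ × ℕ) => ((x.1 : ℝ) ^ 2)⁻¹) hinj).symm
    _ ≤ ∑ x ∈ V, ((x.1 : ℝ) ^ 2)⁻¹ :=
        Finset.sum_le_sum_of_subset_of_nonneg hsub fun _ _ _ => by positivity
    _ = ∑ a ∈ Finset.Icc 1 K, ((K / a : ℕ) : ℝ) * (a + 1) * ((a : ℝ) ^ 2)⁻¹ := by
        simp only [V, Finset.sum_sigma]
        refine Finset.sum_congr rfl fun a _ => ?_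
        simp
    _ ≤ ∑ a ∈ Finset.Icc 1 K, (2 * K) * ((a : ℝ) ^ 2)⁻¹ := by
        refine Finset.sum_le_sum fun a ha => ?_
        have h1 : (1 : ℝ) ≤ a := by exact_mod_cast (Finset.mem_Icc.1 ha).1
        refine mul_le_mul_of_nonneg_right ?_ (by positivity)
        have h2 : ((K / a : ℕ) : ℝ) * a ≤ K := by exact_mod_cast Nat.div_mul_le_self K a
        have h3 : (0 : ℝ) ≤ ((K / a : ℕ) : ℝ) := by positivity
        nlinarith
    _ = (2 * K) * ∑ a ∈ Finset.Icc 1 K, ((a : ℝ) ^ 2)⁻¹ := by rw [Finset.mul_sum]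
    _ ≤ (2 * K) * 2 := by gcongr; exact sum_Icc_inv_sq_le_two K
    _ = 4 * K := by ring

/-- Integer points of prescribed `|P i| = a`, `|P j| = b`, with `|P i|` maximal. -/
theorem card_filter_natAbs_eq_le {d K : ℕ} {i j : Fin d} (hij : i ≠ j) (a b : ℕ) :
    ((intBox d K).filter fun P => (∀ k, (P k).natAbs ≤ (P i).natAbs) ∧
      (P i).natAbs = a ∧ (P j).natAbs = b).card ≤ 4 * (2 * a + 1) ^ (d - 2) := by
  let t : Finset (Fin d → ℤ) := Fintype.piFinset fun k =>
    if k = i then {(a : ℤ), -(a : ℤ)} else if k = j then {(b : ℤ), -(b : ℤ)}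
    else Finset.Icc (-(a : ℤ)) a
  have ht : t.card ≤ 4 * (2 * a + 1) ^ (d - 2) := by
    rw [Fintype.card_piFinset, show 4 = 2 ^ 2 by norm_num, ← prod_ite_two_eq hij]
    refine Finset.prod_le_prod' fun k _ => ?_
    split_ifs
    · exact Finset.card_le_two
    · exact Finset.card_le_two
    · rw [Int.card_Icc]; omega
  refine (Finset.card_le_card fun P hP => ?_).trans ht
  simp only [Finset.mem_filter] at hP
  obtain ⟨-, h1, h2, h3⟩ := hP
  simp only [t, Fintype.mem_piFinset]
  intro k
  split_ifs with hk hk'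
  · subst hk; simp; omega
  · subst hk'; simp; omega
  · have := h1 k; simp; omega

theorem sum_card_nearOrth_sq_of_max_le (e K T : ℕ) (i : Fin (e + 3)) :
    ∑ P ∈ (intBox (e + 3) K).filter (fun P => P i ≠ 0 ∧ ∀ k, (P k).natAbs ≤ (P i).natAbs),
      ((nearOrth (e + 3) K T P).card : ℝ) ^ 2 ≤
      64 * 3 ^ (3 * e + 5) * (K : ℝ) ^ (3 * e + 5) * ((T : ℝ) ^ 2 + K) := by
  obtain ⟨j, hij⟩ : ∃ j : Fin (e + 3), i ≠ j := by
    obtain ⟨j, hj⟩ := exists_ne i; exact ⟨j, hj.symm⟩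
  set D := (intBox (e + 3) K).filter (fun P => P i ≠ 0 ∧ ∀ k, (P k).natAbs ≤ (P i).natAbs) with hD
  have hDm : ∀ P ∈ D, 1 ≤ (P i).natAbs ∧ (P i).natAbs ≤ K ∧ (P j).natAbs ≤ (P i).natAbs := by
    intro P hP
    simp only [hD, Finset.mem_filter, mem_intBox] at hP
    have h1 := abs_le.1 (hP.1 i)
    have h2 := hP.2.2 j
    have h3 := hP.2.1
    omega
  rcases Nat.eq_zero_or_pos K with hK0 | hKpos
  · rw [Finset.sum_eq_zero]
    · positivity
    · intro P hP
      have := hDm P hP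
      omega
  have hK1 : (1 : ℝ) ≤ K := by exact_mod_cast hKpos
  let A : ℝ := (3 * K) ^ (e + 2)
  let F : (Σ _ : ℕ, ℕ) → ℝ := fun u => (A * (2 * T + Nat.gcd u.1 u.2)) ^ 2 / (u.1 : ℝ) ^ 2
  let h : (Fin (e + 3) → ℤ) → (Σ _ : ℕ, ℕ) := fun P => ⟨(P i).natAbs, (P j).natAbs⟩
  let U : Finset (Σ _ : ℕ, ℕ) := (Finset.Icc 1 K).sigma fun a => Finset.range (a + 1)
  have hmaps : ∀ P ∈ D, h P ∈ U := by
    intro P hP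
    have := hDm P hP
    simp only [U, h, Finset.mem_sigma, Finset.mem_Icc, Finset.mem_range]
    omega
  have hF : ∀ P ∈ D, ((nearOrth (e + 3) K T P).card : ℝ) ^ 2 ≤ F (h P) := by
    intro P hP
    obtain ⟨h1, h2, h3⟩ := hDm P hP
    have key := card_nearOrth_mul_le (T := T) hij (by omega : P i ≠ 0) h2
    have key' : ((nearOrth (e + 3) K T P).card : ℝ) * (P i).natAbs ≤
        A * (2 * T + Nat.gcd (P i).natAbs (P j).natAbs) := by
      have hA : (((2 * K + 1) ^ (e + 1) * (3 * K) : ℕ) : ℝ) ≤ A := by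
        simp only [A]
        push_cast
        rw [pow_succ (3 * (K : ℝ)) (e + 1)]
        gcongr
        linarith
      calc _ ≤ ((((2 * K + 1) ^ (e + 1) * (3 * K) : ℕ) : ℝ)) *
            (2 * T + Nat.gcd (P i).natAbs (P j).natAbs) := by
            have : e + 3 - 2 = e + 1 := by omega
            rw [this, ← mul_assoc] at key
            exact_mod_cast key
        _ ≤ _ := by gcongr
    have hpos : (0 : ℝ) < (P i).natAbs := by exact_mod_cast h1
    simp only [F, h]
    rw [le_div_iff₀ (by positivity), ← mul_pow]
    gcongr
  have hcard : ∀ u ∈ U, ((D.filter fun P => h P = u).card : ℝ) ≤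
      4 * 3 ^ (e + 1) * (K : ℝ) ^ e * u.1 := by
    rintro ⟨a, b⟩ hu
    simp only [U, Finset.mem_sigma, Finset.mem_Icc, Finset.mem_range] at hu
    have ha1 : (1 : ℝ) ≤ a := by exact_mod_cast hu.1.1
    have haK : (a : ℝ) ≤ K := by exact_mod_cast hu.1.2
    have h1 : (D.filter fun P => h P = ⟨a, b⟩).card ≤ 4 * (2 * a + 1) ^ (e + 3 - 2) := by
      refine le_trans (Finset.card_le_card fun P hP => ?_)
        (card_filter_natAbs_eq_le (K := K) hij a b)
      simp only [hD, h, Finset.mem_filter, Sigma.mk.injEq, heq_eq_eq] at hP ⊢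
      tauto
    have h2 : e + 3 - 2 = e + 1 := by omega
    rw [h2] at h1
    calc ((D.filter fun P => h P = ⟨a, b⟩).card : ℝ) ≤ 4 * (2 * a + 1) ^ (e + 1) := by
          exact_mod_cast h1
      _ ≤ 4 * (3 * a) ^ (e + 1) := by gcongr; linarith
      _ = 4 * 3 ^ (e + 1) * (a : ℝ) ^ e * a := by ring
      _ ≤ _ := by gcongr
  calc ∑ P ∈ D, ((nearOrth (e + 3) K T P).card : ℝ) ^ 2
      ≤ ∑ P ∈ D, F (h P) := Finset.sum_le_sum hF
    _ = ∑ u ∈ U, ∑ P ∈ D with h P = u, F (h P) :=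
        (Finset.sum_fiberwise_of_maps_to hmaps _).symm
    _ = ∑ u ∈ U, ((D.filter fun P => h P = u).card : ℝ) * F u := by
        refine Finset.sum_congr rfl fun u _ => ?_
        rw [Finset.sum_congr rfl (g := fun _ => F u)]
        · simp
        · intro P hP
          rw [(Finset.mem_filter.1 hP).2]
    _ ≤ ∑ u ∈ U, (4 * 3 ^ (e + 1) * (K : ℝ) ^ e * A ^ 2) *
          (8 * T ^ 2 * (u.1 : ℝ)⁻¹ + 2 * K * ((Nat.gcd u.1 u.2 : ℝ) ^ 2 / (u.1 : ℝ) ^ 2)) := by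
        refine Finset.sum_le_sum fun u hu => ?_
        have hu' := hu
        simp only [U, Finset.mem_sigma, Finset.mem_Icc, Finset.mem_range] at hu'
        have ha1 : (0 : ℝ) < u.1 := by exact_mod_cast hu'.1.1
        have haK : (u.1 : ℝ) ≤ K := by exact_mod_cast hu'.1.2
        have hF0 : 0 ≤ F u := by positivity
        calc _ ≤ (4 * 3 ^ (e + 1) * (K : ℝ) ^ e * u.1) * F u :=
              mul_le_mul_of_nonneg_right (hcard u hu) hF0
          _ = (4 * 3 ^ (e + 1) * (K : ℝ) ^ e * A ^ 2) *
              ((2 * T + Nat.gcd u.1 u.2) ^ 2 * (u.1 : ℝ)⁻¹) := by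
              simp only [F]; field_simp
          _ ≤ (4 * 3 ^ (e + 1) * (K : ℝ) ^ e * A ^ 2) *
              ((8 * T ^ 2 + 2 * (Nat.gcd u.1 u.2) ^ 2) * (u.1 : ℝ)⁻¹) := by
              gcongr
              nlinarith [sq_nonneg (2 * (T : ℝ) - Nat.gcd u.1 u.2)]
          _ ≤ _ := by
              gcongr
              rw [add_mul]
              refine add_le_add le_rfl ?_
              have : 2 * (Nat.gcd u.1 u.2 : ℝ) ^ 2 * (u.1 : ℝ)⁻¹ =
                  2 * u.1 * ((Nat.gcd u.1 u.2 : ℝ) ^ 2 / (u.1 : ℝ) ^ 2) := by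
                field_simp
              rw [this]
              gcongr
    _ = (4 * 3 ^ (e + 1) * (K : ℝ) ^ e * A ^ 2) *
          (8 * T ^ 2 * (∑ a ∈ Finset.Icc 1 K, ∑ b ∈ Finset.range (a + 1), (a : ℝ)⁻¹) +
            2 * K * ∑ a ∈ Finset.Icc 1 K, ∑ b ∈ Finset.range (a + 1),
              ((Nat.gcd a b : ℝ) ^ 2 / (a : ℝ) ^ 2)) := by
        rw [← Finset.mul_sum, Finset.sum_add_distrib, ← Finset.mul_sum, ← Finset.mul_sum]
        simp only [U, Finset.sum_sigma]
    _ ≤ (4 * 3 ^ (e + 1) * (K : ℝ) ^ e * A ^ 2) * (8 * T ^ 2 * (2 * K) + 2 * K * (4 * K)) := by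
        gcongr
        · calc _ ≤ ∑ a ∈ Finset.Icc 1 K, (2 : ℝ) := by
                refine Finset.sum_le_sum fun a ha => ?_
                have h1 : (1 : ℝ) ≤ a := by exact_mod_cast (Finset.mem_Icc.1 ha).1
                simp only [Finset.sum_const, Finset.card_range, nsmul_eq_mul]
                rw [← div_eq_mul_inv, div_le_iff₀ (by linarith)]
                push_cast
                linarith
            _ = 2 * K := by simp [mul_comm]
        · exact sum_gcd_sq_div_sq_le K
    _ = 32 * 3 ^ (3 * e + 5) * (K : ℝ) ^ (3 * e + 5) * (2 * (T : ℝ) ^ 2 + K) := by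
        simp only [A]
        ring
    _ ≤ _ := by
        have : 64 * 3 ^ (3 * e + 5) * (K : ℝ) ^ (3 * e + 5) * ((T : ℝ) ^ 2 + K) =
          32 * 3 ^ (3 * e + 5) * (K : ℝ) ^ (3 * e + 5) * (2 * (T : ℝ) ^ 2 + 2 * K) := by ring
        rw [this]
        gcongr
        linarith

theorem sum_biUnion_le_sum_sum {ι α : Type*} [DecidableEq α] (s : Finset ι) (D : ι → Finset α)
    {f : α → ℝ} (hf : ∀ x, 0 ≤ f x) : ∑ x ∈ s.biUnion D, f x ≤ ∑ i ∈ s, ∑ x ∈ D i, f x := by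
  classical
  induction s using Finset.induction_on with
  | empty => simp
  | insert i s hi ih =>
    rw [Finset.biUnion_insert, Finset.sum_insert hi]
    have h1 := Finset.sum_union_inter (s₁ := D i) (s₂ := s.biUnion D) (f := f)
    have h2 := Finset.sum_nonneg (s := D i ∩ s.biUnion D) fun x _ => hf x
    linarith

theorem sum_card_nearOrth_sq_le (e K T : ℕ) (hK : 1 ≤ K) :
    ∑ P ∈ intBox (e + 3) K, ((nearOrth (e + 3) K T P).card : ℝ) ^ 2 ≤
      (64 * (e + 4) * 3 ^ (3 * e + 6)) * (K : ℝ) ^ (3 * e + 5) * ((T : ℝ) ^ 2 + K) := by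
  have hK1 : (1 : ℝ) ≤ K := by exact_mod_cast hK
  let D : Fin (e + 3) → Finset (Fin (e + 3) → ℤ) := fun i =>
    (intBox (e + 3) K).filter (fun P => P i ≠ 0 ∧ ∀ k, (P k).natAbs ≤ (P i).natAbs)
  have hsub : intBox (e + 3) K ⊆ {0} ∪ Finset.univ.biUnion D := by
    intro P hP
    by_cases h0 : P = 0
    · simp [h0]
    obtain ⟨i, -, hi⟩ := Finset.exists_max_image Finset.univ (fun k => (P k).natAbs)
      Finset.univ_nonempty
    refine Finset.mem_union_right _ (Finset.mem_biUnion.2 ⟨i, Finset.mem_univ i,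
      Finset.mem_filter.2 ⟨hP, ?_, fun k => hi k (Finset.mem_univ k)⟩⟩)
    intro hPi
    apply h0
    funext k
    have := hi k (Finset.mem_univ k)
    rw [hPi] at this
    simpa using this
  have hzero : ((nearOrth (e + 3) K T 0).card : ℝ) ^ 2 ≤
      3 ^ (3 * e + 6) * (K : ℝ) ^ (3 * e + 6) := by
    have h1 : ((nearOrth (e + 3) K T 0).card : ℝ) ≤ (2 * K + 1) ^ (e + 3) := by
      have := Finset.card_filter_le (intBox (e + 3) K) fun Q => |(0 : Fin (e + 3) → ℤ) ⬝ᵥ Q| ≤ T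
      rw [card_intBox] at this
      exact_mod_cast this
    calc _ ≤ (((2 * K + 1) ^ (e + 3)) ^ 2 : ℝ) := by gcongr
      _ ≤ ((3 * K) ^ (e + 3)) ^ 2 := by gcongr; linarith
      _ = (3 * K : ℝ) ^ (2 * e + 6) := by ring
      _ ≤ (3 * K : ℝ) ^ (3 * e + 6) := pow_le_pow_right₀ (by linarith) (by omega)
      _ = _ := by rw [mul_pow]
  calc _ ≤ ∑ P ∈ {0} ∪ Finset.univ.biUnion D, ((nearOrth (e + 3) K T P).card : ℝ) ^ 2 :=
        Finset.sum_le_sum_of_subset_of_nonneg hsub fun _ _ _ => by positivity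
    _ ≤ ∑ P ∈ {0}, ((nearOrth (e + 3) K T P).card : ℝ) ^ 2 +
        ∑ P ∈ Finset.univ.biUnion D, ((nearOrth (e + 3) K T P).card : ℝ) ^ 2 := by
        rw [← Finset.sum_union_inter]
        exact le_add_of_nonneg_right (Finset.sum_nonneg fun _ _ => by positivity)
    _ ≤ 3 ^ (3 * e + 6) * (K : ℝ) ^ (3 * e + 6) +
        ∑ i, ∑ P ∈ D i, ((nearOrth (e + 3) K T P).card : ℝ) ^ 2 := by
        refine add_le_add (by simpa using hzero) ?_
        exact sum_biUnion_le_sum_sum _ _ fun _ => by positivity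
    _ ≤ 3 ^ (3 * e + 6) * (K : ℝ) ^ (3 * e + 6) +
        ∑ _i : Fin (e + 3), 64 * 3 ^ (3 * e + 5) * (K : ℝ) ^ (3 * e + 5) * ((T : ℝ) ^ 2 + K) := by
        gcongr with i
        exact sum_card_nearOrth_sq_of_max_le e K T i
    _ = (3 * K + (e + 3) * 64 * ((T : ℝ) ^ 2 + K)) *
          (3 ^ (3 * e + 5) * (K : ℝ) ^ (3 * e + 5)) := by
        simp only [Finset.sum_const, Finset.card_univ, Fintype.card_fin, nsmul_eq_mul]
        push_cast
        ring
    _ ≤ (64 * (e + 4) * 3 * ((T : ℝ) ^ 2 + K)) * (3 ^ (3 * e + 5) * (K : ℝ) ^ (3 * e + 5)) := by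
        gcongr
        have h1 : (0 : ℝ) ≤ e * ((T : ℝ) ^ 2 + K) := by positivity
        nlinarith [sq_nonneg (T : ℝ)]
    _ = _ := by ring

theorem card_le_of_forall_sub_mem {G : Type*} [AddGroup G] [DecidableEq G] (s t : Finset G)
    (h : ∀ x ∈ s, ∀ y ∈ s, x - y ∈ t) : s.card ≤ t.card := by
  rcases s.eq_empty_or_nonempty with rfl | ⟨y, hy⟩
  · simp
  · exact Finset.card_le_card_of_injOn (fun x => x - y) (fun x hx => h x hx y hy)
      fun _ _ _ _ hxy => sub_left_injective hxy

/-- Differencing in the first variable, then in each of the other two, reduces the count of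
triples to a homogeneous one. -/
theorem card_triples_le_sum_card_nearOrth_sq (d K T : ℕ)
    (F : Finset ((Fin d → ℤ) × (Fin d → ℤ) × (Fin d → ℤ)))
    (hfst : ∀ u ∈ F, ∀ w ∈ F, u.2 = w.2 → u.1 - w.1 ∈ intBox d K ∧
      |(u.1 - w.1) ⬝ᵥ u.2.1| ≤ T ∧ |(u.1 - w.1) ⬝ᵥ u.2.2| ≤ T)
    (hsnd : ∀ u ∈ F, ∀ w ∈ F, u.2.1 - w.2.1 ∈ intBox d K ∧ u.2.2 - w.2.2 ∈ intBox d K) :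
    F.card ≤ ∑ P ∈ intBox d K, (nearOrth d K (2 * T) P).card ^ 2 := by
  let A := F.image Prod.snd
  let B : Finset ((Fin d → ℤ) × (Fin d → ℤ) × (Fin d → ℤ)) :=
    (intBox d K ×ˢ A).filter fun q => |q.1 ⬝ᵥ q.2.1| ≤ T ∧ |q.1 ⬝ᵥ q.2.2| ≤ T
  have hFB : F.card ≤ B.card := by
    rw [Finset.card_eq_sum_card_fiberwise (f := Prod.snd) (t := A)
        (fun x hx => Finset.mem_image_of_mem _ hx),
      Finset.card_eq_sum_card_fiberwise (s := B) (f := Prod.snd) (t := A)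
        (fun x hx => (Finset.mem_product.1 (Finset.mem_filter.1 hx).1).2)]
    refine Finset.sum_le_sum fun a ha => ?_
    have hinj : Set.InjOn (Prod.fst : (Fin d → ℤ) × (Fin d → ℤ) × (Fin d → ℤ) → _)
        (F.filter fun x => x.2 = a) := by
      intro x hx y hy hxy
      exact Prod.ext hxy ((Finset.mem_filter.1 hx).2.trans (Finset.mem_filter.1 hy).2.symm)
    have hinj' : Set.InjOn (Prod.fst : (Fin d → ℤ) × (Fin d → ℤ) × (Fin d → ℤ) → _)
        (B.filter fun x => x.2 = a) := by
      intro x hx y hy hxy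
      exact Prod.ext hxy ((Finset.mem_filter.1 hx).2.trans (Finset.mem_filter.1 hy).2.symm)
    rw [← Finset.card_image_of_injOn hinj, ← Finset.card_image_of_injOn hinj']
    apply card_le_of_forall_sub_mem
    intro x hx y hy
    obtain ⟨u, hu, rfl⟩ := Finset.mem_image.1 hx
    obtain ⟨w, hw, rfl⟩ := Finset.mem_image.1 hy
    rw [Finset.mem_filter] at hu hw
    obtain ⟨h1, h2, h3⟩ := hfst u hu.1 w hw.1 (hu.2.trans hw.2.symm)
    rw [hu.2] at h2 h3
    refine Finset.mem_image.2 ⟨(u.1 - w.1, a), ?_, rfl⟩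
    simp only [B, Finset.mem_filter, Finset.mem_product]
    exact ⟨⟨⟨h1, ha⟩, h2, h3⟩, trivial⟩
  refine hFB.trans ?_
  rw [Finset.card_eq_sum_card_fiberwise (s := B) (f := Prod.fst) (t := intBox d K)
        (fun x hx => (Finset.mem_product.1 (Finset.mem_filter.1 hx).1).1)]
  refine Finset.sum_le_sum fun P _ => ?_
  have hslice : ∀ π : (Fin d → ℤ) × (Fin d → ℤ) → (Fin d → ℤ),
      (∀ u ∈ F, ∀ w ∈ F, π u.2 - π w.2 ∈ intBox d K) →
      ((A.image π).filter fun Q => |P ⬝ᵥ Q| ≤ T).card ≤ (nearOrth d K (2 * T) P).card := by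
    intro π hπ
    apply card_le_of_forall_sub_mem
    intro x hx y hy
    simp only [A, Finset.mem_filter, Finset.mem_image] at hx hy
    obtain ⟨⟨_, ⟨u, hu, rfl⟩, rfl⟩, hx⟩ := hx
    obtain ⟨⟨_, ⟨w, hw, rfl⟩, rfl⟩, hy⟩ := hy
    refine Finset.mem_filter.2 ⟨hπ u hu w hw, ?_⟩
    rw [dotProduct_sub]
    push_cast
    rw [abs_le] at *
    constructor <;> linarith
  rw [sq]
  refine le_trans ?_ (Nat.mul_le_mul (hslice Prod.fst fun u hu w hw => (hsnd u hu w hw).1)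
    (hslice Prod.snd fun u hu w hw => (hsnd u hu w hw).2))
  rw [← Finset.card_product]
  refine Finset.card_le_card_of_injOn Prod.snd ?_ ?_
  · intro x hx
    simp only [B, Finset.coe_filter, Finset.mem_filter, Finset.mem_product, Set.mem_ofPred_eq] at hx
    obtain ⟨⟨⟨-, hxA⟩, h1, h2⟩, rfl⟩ := hx
    simp only [Finset.coe_product, Set.mem_prod, Finset.mem_coe, Finset.mem_filter]
    exact ⟨⟨Finset.mem_image_of_mem _ hxA, h1⟩, ⟨Finset.mem_image_of_mem _ hxA, h2⟩⟩
  · intro x hx y hy hxy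
    exact Prod.ext ((Finset.mem_filter.1 hx).2.trans (Finset.mem_filter.1 hy).2.symm) hxy

theorem abs_le_natFloor_of_abs_cast_le {z : ℤ} {c : ℝ} (h : |(z : ℝ)| ≤ c) :
    |z| ≤ (⌊c⌋₊ : ℤ) := by
  have h1 : z.natAbs ≤ ⌊c⌋₊ := Nat.le_floor (by rw [Nat.cast_natAbs]; push_cast; exact h)
  rw [Int.abs_eq_natAbs]
  exact_mod_cast h1

/-- The integer vector nearest to `L • x`. -/
def scaleRound (d : ℕ) (L : ℝ) (x : EuclideanSpace ℝ (Fin d)) : Fin d → ℤ :=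
  fun i => round (L * x i)

theorem cast_scaleRound {d : ℕ} {L : ℝ} (hL : 0 < L) {x : EuclideanSpace ℝ (Fin d)}
    (hx : x ∈ ZLat d L) (i : Fin d) : (scaleRound d L x i : ℝ) = L * x i := by
  obtain ⟨m, hm⟩ := hx i
  have : L * x i = m := by rw [hm]; field_simp
  simp [scaleRound, this]

theorem scaleRound_injOn {d : ℕ} {L : ℝ} (hL : 0 < L) :
    Set.InjOn (scaleRound d L) (ZLat d L) := by
  intro x hx y hy h
  ext i
  have h1 := cast_scaleRound hL hx i
  rw [h, cast_scaleRound hL hy i] at h1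
  exact (mul_left_cancel₀ hL.ne' h1).symm

theorem scaleRound_sub_mem_intBox {d : ℕ} {L : ℝ} (hL : 0 < L) {x y : EuclideanSpace ℝ (Fin d)}
    (hx : x ∈ ZLat d L) (hy : y ∈ ZLat d L) (h : ‖x - y‖ ≤ 2) :
    scaleRound d L x - scaleRound d L y ∈ intBox d ⌊2 * L⌋₊ := by
  refine mem_intBox.2 fun i => abs_le_natFloor_of_abs_cast_le ?_
  have h1 : |(x - y) i| ≤ 2 := (PiLp.norm_apply_le (x - y) i).trans h
  simp only [Pi.sub_apply, Int.cast_sub, cast_scaleRound hL hx, cast_scaleRound hL hy]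
  rw [← mul_sub, abs_mul, abs_of_pos hL]
  have h2 : |x i - y i| ≤ 2 := h1
  nlinarith

theorem abs_scaleRound_dotProduct_le {d : ℕ} {L ε : ℝ} (hL : 0 < L)
    {x y z : EuclideanSpace ℝ (Fin d)} (hx : x ∈ ZLat d L) (hy : y ∈ ZLat d L)
    (hz : z ∈ ZLat d L) (h : |⟪x - y, z⟫| ≤ 2 * ε) :
    |(scaleRound d L x - scaleRound d L y) ⬝ᵥ scaleRound d L z| ≤ ⌊2 * (ε * L ^ 2)⌋₊ := by
  apply abs_le_natFloor_of_abs_cast_le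
  have e : (((scaleRound d L x - scaleRound d L y) ⬝ᵥ scaleRound d L z : ℤ) : ℝ) =
      L ^ 2 * ⟪x - y, z⟫ := by
    simp only [dotProduct, PiLp.inner_apply, Pi.sub_apply, Int.cast_sum, Int.cast_mul,
      Int.cast_sub, cast_scaleRound hL hx, cast_scaleRound hL hy, cast_scaleRound hL hz,
      Finset.mul_sum]
    refine Finset.sum_congr rfl fun i _ => ?_
    simp
    ring
  rw [e, abs_mul, abs_of_pos (by positivity)]
  nlinarith [sq_nonneg L]

theorem card_lattice_triples_le {d : ℕ} {L ε : ℝ} (hL : 0 < L)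
    (F : Finset (EuclideanSpace ℝ (Fin d) × EuclideanSpace ℝ (Fin d) × EuclideanSpace ℝ (Fin d)))
    (hlat : ∀ u ∈ F, u.1 ∈ ZLat d L ∧ u.2.1 ∈ ZLat d L ∧ u.2.2 ∈ ZLat d L)
    (hfst : ∀ u ∈ F, ∀ w ∈ F, u.2 = w.2 → ‖u.1 - w.1‖ ≤ 2 ∧
      |⟪u.1 - w.1, u.2.1⟫| ≤ 2 * ε ∧ |⟪u.1 - w.1, u.2.2⟫| ≤ 2 * ε)
    (hsnd : ∀ u ∈ F, ∀ w ∈ F, ‖u.2.1 - w.2.1‖ ≤ 2 ∧ ‖u.2.2 - w.2.2‖ ≤ 2) :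
    F.card ≤ ∑ P ∈ intBox d ⌊2 * L⌋₊,
      (nearOrth d ⌊2 * L⌋₊ (2 * ⌊2 * (ε * L ^ 2)⌋₊) P).card ^ 2 := by
  classical
  let r := scaleRound d L
  have hinj : Set.InjOn (fun u : EuclideanSpace ℝ (Fin d) × EuclideanSpace ℝ (Fin d) ×
      EuclideanSpace ℝ (Fin d) => (r u.1, r u.2.1, r u.2.2)) F := by
    intro u hu w hw h
    obtain ⟨h1, h2, h3⟩ := hlat u hu
    obtain ⟨h1', h2', h3'⟩ := hlat w hw
    simp only [Prod.mk.injEq] at h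
    exact Prod.ext (scaleRound_injOn hL h1 h1' h.1)
      (Prod.ext (scaleRound_injOn hL h2 h2' h.2.1) (scaleRound_injOn hL h3 h3' h.2.2))
  rw [← Finset.card_image_of_injOn hinj]
  apply card_triples_le_sum_card_nearOrth_sq
  · intro x hx y hy hxy
    obtain ⟨u, hu, rfl⟩ := Finset.mem_image.1 hx
    obtain ⟨w, hw, rfl⟩ := Finset.mem_image.1 hy
    obtain ⟨h1, h2, h3⟩ := hlat u hu
    obtain ⟨h1', h2', h3'⟩ := hlat w hw
    simp only [Prod.mk.injEq] at hxy
    obtain ⟨k1, k2, k3⟩ := hfst u hu w hw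
      (Prod.ext (scaleRound_injOn hL h2 h2' hxy.1) (scaleRound_injOn hL h3 h3' hxy.2))
    exact ⟨scaleRound_sub_mem_intBox hL h1 h1' k1, abs_scaleRound_dotProduct_le hL h1 h1' h2 k2,
      abs_scaleRound_dotProduct_le hL h1 h1' h3 k3⟩
  · intro x hx y hy
    obtain ⟨u, hu, rfl⟩ := Finset.mem_image.1 hx
    obtain ⟨w, hw, rfl⟩ := Finset.mem_image.1 hy
    obtain ⟨h1, h2, h3⟩ := hlat u hu
    obtain ⟨h1', h2', h3'⟩ := hlat w hw
    obtain ⟨k1, k2⟩ := hsnd u hu w hw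
    exact ⟨scaleRound_sub_mem_intBox hL h2 h2' k1, scaleRound_sub_mem_intBox hL h3 h3' k2⟩

theorem norm_sub_le_two_of_norm_sub_le_one {E : Type*} [SeminormedAddCommGroup E] {x y c : E}
    (hx : ‖x - c‖ ≤ 1) (hy : ‖y - c‖ ≤ 1) : ‖x - y‖ ≤ 2 := by
  have : x - y = (x - c) - (y - c) := by abel
  rw [this]
  linarith [norm_sub_le (x - c) (y - c)]

theorem count2_le_sum_card_nearOrth_sq {d : ℕ} {L δ γ α β : ℝ} (hL : 0 < L)
    {v x0 y0 z0 : EuclideanSpace ℝ (Fin d)}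
    {ζ : EuclideanSpace ℝ (Fin d) → EuclideanSpace ℝ (Fin d) → EuclideanSpace ℝ (Fin d) →
      EuclideanSpace ℝ (Fin d)}
    (hζ : (∀ x y z, ζ x y z = x - v) ∨ (∀ x y z, ζ x y z = x + y - v) ∨
        (∀ x y z, ζ x y z = x + y - v - z)) :
    count2 d L δ γ α β v x0 y0 z0 ζ ≤ ∑ P ∈ intBox d ⌊2 * L⌋₊,
      (nearOrth d ⌊2 * L⌋₊ (2 * ⌊2 * (δ⁻¹ * L ^ (-(2 * γ)) * L ^ 2)⌋₊) P).card ^ 2 := by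
  classical
  unfold count2
  set ε := δ⁻¹ * L ^ (-(2 * γ)) with hε
  set S := {q : EuclideanSpace ℝ (Fin d) × EuclideanSpace ℝ (Fin d) × EuclideanSpace ℝ (Fin d) |
    q.1 ∈ ZLat d L ∧ q.2.1 ∈ ZLat d L ∧ q.2.2 ∈ ZLat d L ∧
    ‖q.1 - x0‖ ≤ 1 ∧ ‖q.2.1 - y0‖ ≤ 1 ∧ ‖q.2.2 - z0‖ ≤ 1 ∧
    |⟪q.1, q.2.1⟫ - α| ≤ ε ∧ |⟪ζ q.1 q.2.1 q.2.2, q.2.2⟫ - β| ≤ ε} with hS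
  rcases S.finite_or_infinite with hfin | hinf
  swap
  · rw [hinf.ncard]; exact Nat.zero_le _
  rw [Set.ncard_eq_toFinset_card S hfin]
  have hm : ∀ q ∈ hfin.toFinset, q ∈ S := fun q hq => hfin.mem_toFinset.1 hq
  have hcancel : ∀ {s t a : ℝ}, |s - a| ≤ ε → |t - a| ≤ ε → |s - t| ≤ 2 * ε := by
    intro s t a hs ht
    rw [abs_le] at *
    constructor <;> linarith
  by_cases hA : ∀ x y z, ζ x y z = x - v
  · apply card_lattice_triples_le hL
    · intro u hu
      obtain ⟨h1, h2, h3, -⟩ := hm u hu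
      exact ⟨h1, h2, h3⟩
    · rintro ⟨x, y, z⟩ hu ⟨x', y', z'⟩ hw h
      obtain ⟨-, -, -, n1, n2, n3, h1, h2⟩ := hm _ hu
      obtain ⟨-, -, -, n1', n2', n3', h1', h2'⟩ := hm _ hw
      simp only [Prod.mk.injEq] at h
      obtain ⟨rfl, rfl⟩ := h
      simp only [hA] at *
      refine ⟨norm_sub_le_two_of_norm_sub_le_one n1 n1', ?_, ?_⟩
      · rw [inner_sub_left]; exact hcancel h1 h1'
      · have := hcancel h2 h2'
        rwa [← inner_sub_left, sub_sub_sub_cancel_right] at this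
    · intro u hu w hw
      obtain ⟨-, -, -, n1, n2, n3, -⟩ := hm _ hu
      obtain ⟨-, -, -, n1', n2', n3', -⟩ := hm _ hw
      exact ⟨norm_sub_le_two_of_norm_sub_le_one n2 n2', norm_sub_le_two_of_norm_sub_le_one n3 n3'⟩
  · have hB : ∀ x y y' z, ζ x y z - ζ x y' z = y - y' := by
      rcases hζ with h | h | h
      · exact absurd h hA
      · intro x y y' z; rw [h, h]; abel
      · intro x y y' z; rw [h, h]; abel
    let swap : EuclideanSpace ℝ (Fin d) × EuclideanSpace ℝ (Fin d) × EuclideanSpace ℝ (Fin d) →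
      EuclideanSpace ℝ (Fin d) × EuclideanSpace ℝ (Fin d) × EuclideanSpace ℝ (Fin d) :=
      fun q => (q.2.1, q.1, q.2.2)
    have hswap : Function.Injective swap := by
      intro p q h
      simp only [swap, Prod.mk.injEq] at h
      exact Prod.ext h.2.1 (Prod.ext h.1 h.2.2)
    rw [← Finset.card_image_of_injective _ hswap]
    apply card_lattice_triples_le hL
    · intro p hp
      obtain ⟨u, hu, rfl⟩ := Finset.mem_image.1 hp
      obtain ⟨h1, h2, h3, -⟩ := hm u hu
      exact ⟨h2, h1, h3⟩
    · intro p hp q hq h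
      obtain ⟨⟨x, y, z⟩, hu, rfl⟩ := Finset.mem_image.1 hp
      obtain ⟨⟨x', y', z'⟩, hw, rfl⟩ := Finset.mem_image.1 hq
      obtain ⟨-, -, -, n1, n2, n3, h1, h2⟩ := hm _ hu
      obtain ⟨-, -, -, n1', n2', n3', h1', h2'⟩ := hm _ hw
      simp only [swap, Prod.mk.injEq] at h
      obtain ⟨rfl, rfl⟩ := h
      simp only [swap] at *
      refine ⟨norm_sub_le_two_of_norm_sub_le_one n2 n2', ?_, ?_⟩
      · rw [real_inner_comm, inner_sub_right]; exact hcancel h1 h1'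
      · have := hcancel h2 h2'
        rwa [← inner_sub_left, hB] at this
    · intro p hp q hq
      obtain ⟨u, hu, rfl⟩ := Finset.mem_image.1 hp
      obtain ⟨w, hw, rfl⟩ := Finset.mem_image.1 hq
      obtain ⟨-, -, -, n1, n2, n3, -⟩ := hm _ hu
      obtain ⟨-, -, -, n1', n2', n3', -⟩ := hm _ hw
      exact ⟨norm_sub_le_two_of_norm_sub_le_one n1 n1', norm_sub_le_two_of_norm_sub_le_one n3 n3'⟩

theorem count2_le_mul_rpow (e : ℕ) : ∃ C : ℝ, 2 ≤ C ∧ ∀ L δ γ α β p : ℝ, 2 ≤ L → 0 < δ → δ < 1 →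
    3 * ((e + 3 : ℕ) : ℝ) - 4 * γ ≤ p → 3 * ((e + 3 : ℕ) : ℝ) - 3 ≤ p →
    ∀ (v x0 y0 z0 : EuclideanSpace ℝ (Fin (e + 3)))
      (ζ : EuclideanSpace ℝ (Fin (e + 3)) → EuclideanSpace ℝ (Fin (e + 3)) →
        EuclideanSpace ℝ (Fin (e + 3)) → EuclideanSpace ℝ (Fin (e + 3))),
      ((∀ x y z, ζ x y z = x - v) ∨ (∀ x y z, ζ x y z = x + y - v) ∨
        (∀ x y z, ζ x y z = x + y - v - z)) →
      (count2 (e + 3) L δ γ α β v x0 y0 z0 ζ : ℝ) ≤ C * δ⁻¹ ^ 2 * L ^ p := by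
  set C₀ : ℝ := 64 * (e + 4) * 3 ^ (3 * e + 6) with hC₀
  have hC₀1 : 1 ≤ C₀ := by
    have h1 : (1 : ℝ) ≤ 3 ^ (3 * e + 6) := one_le_pow₀ (by norm_num)
    have h2 : (0 : ℝ) ≤ e := by positivity
    rw [hC₀]
    nlinarith
  refine ⟨C₀ * 2 ^ (3 * e + 5) * 32, ?_, ?_⟩
  · have h1 : (1 : ℝ) ≤ 2 ^ (3 * e + 5) := one_le_pow₀ (by norm_num)
    nlinarith
  intro L δ γ α β p hL hδ hδ1 hp1 hp2 v x0 y0 z0 ζ hζ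
  have hL0 : 0 < L := by linarith
  have hδi : 1 ≤ δ⁻¹ := (one_le_inv₀ hδ).2 hδ1.le
  set W := δ⁻¹ * L ^ (-(2 * γ)) * L ^ 2 with hW
  have hW0 : 0 ≤ W := by positivity
  have hK : 1 ≤ ⌊2 * L⌋₊ := Nat.le_floor (by push_cast; linarith)
  have hKL : (⌊2 * L⌋₊ : ℝ) ≤ 2 * L := Nat.floor_le (by positivity)
  have hTW : (⌊2 * W⌋₊ : ℝ) ≤ 2 * W := Nat.floor_le (by positivity)
  have e1 : L ^ (3 * e + 5) * W ^ 2 ≤ δ⁻¹ ^ 2 * L ^ p := by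
    have : L ^ (3 * e + 5) * W ^ 2 = δ⁻¹ ^ 2 * L ^ (3 * ((e + 3 : ℕ) : ℝ) - 4 * γ) := by
      have h1 : 3 * ((e + 3 : ℕ) : ℝ) - 4 * γ =
          -(2 * γ) + -(2 * γ) + ((3 * e + 9 : ℕ) : ℝ) := by
        push_cast; ring
      rw [h1, Real.rpow_add hL0, Real.rpow_add hL0, Real.rpow_natCast, hW]
      ring
    rw [this]
    gcongr
    linarith
  have e2 : L ^ (3 * e + 5) * L ≤ δ⁻¹ ^ 2 * L ^ p := by
    have h1 : L ^ (3 * e + 5) * L = L ^ (3 * ((e + 3 : ℕ) : ℝ) - 3) := by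
      rw [← pow_succ, ← Real.rpow_natCast]
      congr 1
      push_cast
      ring
    calc L ^ (3 * e + 5) * L = 1 * L ^ (3 * ((e + 3 : ℕ) : ℝ) - 3) := by rw [h1, one_mul]
      _ ≤ _ := by
        gcongr
        · exact one_le_pow₀ hδi
        · linarith
  calc (count2 (e + 3) L δ γ α β v x0 y0 z0 ζ : ℝ)
      ≤ ∑ P ∈ intBox (e + 3) ⌊2 * L⌋₊,
        ((nearOrth (e + 3) ⌊2 * L⌋₊ (2 * ⌊2 * W⌋₊) P).card : ℝ) ^ 2 := by
        exact_mod_cast count2_le_sum_card_nearOrth_sq hL0 hζ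
    _ ≤ C₀ * (⌊2 * L⌋₊ : ℝ) ^ (3 * e + 5) * (((2 * ⌊2 * W⌋₊ : ℕ) : ℝ) ^ 2 + ⌊2 * L⌋₊) :=
        sum_card_nearOrth_sq_le e _ _ hK
    _ ≤ C₀ * (2 * L) ^ (3 * e + 5) * ((2 * (2 * W)) ^ 2 + 2 * L) := by
        push_cast
        gcongr
    _ = C₀ * 2 ^ (3 * e + 5) * (16 * (L ^ (3 * e + 5) * W ^ 2) + 2 * (L ^ (3 * e + 5) * L)) := by
        ring
    _ ≤ C₀ * 2 ^ (3 * e + 5) * (16 * (δ⁻¹ ^ 2 * L ^ p) + 16 * (δ⁻¹ ^ 2 * L ^ p)) := by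
        gcongr
        norm_num
    _ = _ := by ring

theorem statement4 (d : ℕ) (hd : 3 ≤ d) (γ : ℝ) (hγ : 0 < γ) (hγ' : γ < 1) :
    ∃ η₀ : ℝ, 0 < η₀ ∧ ∀ η : ℝ, 0 < η → η ≤ η₀ →
    ∃ C : ℝ, 2 ≤ C ∧
    ∀ L δ : ℝ, C ≤ L → 0 < δ → δ < 1 → δ⁻¹ ≤ L ^ (η ^ 2) →
    ∀ (α β : ℝ) (v : EuclideanSpace ℝ (Fin d)), v ∈ ZLat d L →
    ∀ (x0 y0 z0 : EuclideanSpace ℝ (Fin d))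
      (ζ : EuclideanSpace ℝ (Fin d) → EuclideanSpace ℝ (Fin d) → EuclideanSpace ℝ (Fin d) →
        EuclideanSpace ℝ (Fin d)),
      ((∀ x y z, ζ x y z = x - v) ∨ (∀ x y z, ζ x y z = x + y - v) ∨
        (∀ x y z, ζ x y z = x + y - v - z)) →
      ((γ ≤ 1 / 2 →
          (count2 d L δ γ α β v x0 y0 z0 ζ : ℝ) ≤
            C * δ⁻¹ ^ 2 * L ^ (3 * (d : ℝ) - 4 * γ)) ∧
        (1 / 2 < γ →
          (count2 d L δ γ α β v x0 y0 z0 ζ : ℝ) ≤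
            C * δ⁻¹ ^ 2 * L ^ (3 * ((d : ℝ) - γ) - min γ (1 - γ) - 10 * η)) ∧
        (count2 d L δ γ α β v x0 y0 z0 ζ : ℝ) ≤
          C * δ⁻¹ ^ 2 * L ^ (3 * ((d : ℝ) - γ) - min γ (1 - γ))) := by
  obtain ⟨e, rfl⟩ : ∃ e, d = e + 3 := ⟨d - 3, by omega⟩
  obtain ⟨C, hC2, hC⟩ := count2_le_mul_rpow e
  refine ⟨if γ ≤ 1 / 2 then 1 else min ((1 - γ) / 5) ((2 * γ - 1) / 10), ?_, ?_⟩
  · split_ifs with h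
    · norm_num
    · push Not at h
      exact lt_min (by linarith) (by linarith)
  intro η _ hη₀
  refine ⟨C, hC2, ?_⟩
  intro L δ hL hδ hδ1 _ α β v _ x0 y0 z0 ζ hζ
  have bound : ∀ p : ℝ, 3 * ((e + 3 : ℕ) : ℝ) - 4 * γ ≤ p → 3 * ((e + 3 : ℕ) : ℝ) - 3 ≤ p →
      (count2 (e + 3) L δ γ α β v x0 y0 z0 ζ : ℝ) ≤ C * δ⁻¹ ^ 2 * L ^ p :=
    fun p h1 h2 => hC L δ γ α β p (hC2.trans hL) hδ hδ1 h1 h2 v x0 y0 z0 ζ hζ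
  refine ⟨fun h => bound _ le_rfl (by linarith), fun h => ?_, ?_⟩
  · rw [if_neg (not_le.2 h)] at hη₀
    have h1 := hη₀.trans (min_le_left _ _)
    have h2 := hη₀.trans (min_le_right _ _)
    rw [min_eq_right (by linarith : 1 - γ ≤ γ)]
    exact bound _ (by linarith) (by linarith)
  · have h1 := min_le_left γ (1 - γ)
    have h2 := min_le_right γ (1 - γ)
    refine bound _ (by linarith) ?_
    rcases le_total γ (1 / 2) with h | h <;> linarith
end
end

section
/- For every k ∈ ℤ_L^d and β ∈ ℝ, the number of pairs (k₁,k₂) ∈ (ℤ_L^d)² with |k₁ − k₁⁰| ≤ 1, |k₂ − k₂⁰| ≤ 1, k₁ + k₂ = k, and | |k₁|² + |k₂|² − β | ≤ δ^{−1}L^{−2γ}, is at most C·δ^{−1}·L^{d−γ−γ₀}. -/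
open scoped RealInnerProductSpace BigOperators

noncomputable section

theorem card_le_of_forall_sub_le (T : Finset ℤ) (D : ℝ) (hD : 0 ≤ D)
    (h : ∀ x ∈ T, ∀ y ∈ T, ((y : ℝ) - x) ≤ D) : (T.card : ℝ) ≤ D + 1 := by
  rcases T.eq_empty_or_nonempty with rfl | hT
  · simp; linarith
  · have hsub : T ⊆ Finset.Icc (T.min' hT) (T.max' hT) := fun x hx =>
      Finset.mem_Icc.2 ⟨T.min'_le x hx, T.le_max' x hx⟩
    have hle : T.min' hT ≤ T.max' hT := T.min'_le _ (T.max'_mem hT)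
    have hcard := Finset.card_le_card hsub
    rw [Int.card_Icc] at hcard
    have hcard' : (T.card : ℤ) ≤ T.max' hT + 1 - T.min' hT := by omega
    have hreal : (T.card : ℝ) ≤ (T.max' hT : ℝ) + 1 - (T.min' hT : ℝ) := by exact_mod_cast hcard'
    linarith [h _ (T.min'_mem hT) _ (T.max'_mem hT)]

theorem card_le_of_sq_near (T : Finset ℤ) (μ b l : ℝ) (hμ : 0 < μ) (hl : 0 ≤ l)
    (h0 : ∀ x ∈ T, x ≠ 0 → μ ≤ |(x : ℝ)|) (hb : ∀ x ∈ T, |(x : ℝ) ^ 2 - b| ≤ l) :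
    (T.card : ℝ) ≤ 3 + 2 * (l / μ) := by
  have hdiff : ∀ x y : ℝ, μ ≤ x → μ ≤ y → |x ^ 2 - b| ≤ l → |y ^ 2 - b| ≤ l →
      y - x ≤ l / μ := by
    intro x y hx hy hxb hyb
    rw [abs_le] at hxb hyb
    rw [le_div_iff₀ hμ]
    rcases le_total y x with hyx | hyx
    · nlinarith
    · nlinarith [mul_le_mul_of_nonneg_left (add_le_add hx hy) (sub_nonneg.2 hyx)]
  have hpos : ((T.filter (0 < ·)).card : ℝ) ≤ l / μ + 1 := by
    refine card_le_of_forall_sub_le _ _ (by positivity) fun x hx y hy => ?_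
    rw [Finset.mem_filter] at hx hy
    have hx' : (0 : ℝ) < x := by exact_mod_cast hx.2
    have hy' : (0 : ℝ) < y := by exact_mod_cast hy.2
    have h1 := h0 x hx.1 hx.2.ne'
    have h2 := h0 y hy.1 hy.2.ne'
    rw [abs_of_pos hx'] at h1
    rw [abs_of_pos hy'] at h2
    exact hdiff x y h1 h2 (hb x hx.1) (hb y hy.1)
  have hneg : ((T.filter (· < 0)).card : ℝ) ≤ l / μ + 1 := by
    refine card_le_of_forall_sub_le _ _ (by positivity) fun x hx y hy => ?_
    rw [Finset.mem_filter] at hx hy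
    have hx' : (x : ℝ) < 0 := by exact_mod_cast hx.2
    have hy' : (y : ℝ) < 0 := by exact_mod_cast hy.2
    have h1 := h0 x hx.1 hx.2.ne
    have h2 := h0 y hy.1 hy.2.ne
    rw [abs_of_neg hx'] at h1
    rw [abs_of_neg hy'] at h2
    have h3 := hdiff (-y) (-x) h2 h1 (by rw [neg_sq]; exact hb y hy.1)
      (by rw [neg_sq]; exact hb x hx.1)
    linarith
  have hsub : T ⊆ {0} ∪ (T.filter (0 < ·) ∪ T.filter (· < 0)) := by
    intro x hx
    simp only [Finset.mem_union, Finset.mem_singleton, Finset.mem_filter, hx, true_and]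
    omega
  have hcard : T.card ≤ 1 + ((T.filter (0 < ·)).card + (T.filter (· < 0)).card) :=
    (Finset.card_le_card hsub).trans <| (Finset.card_union_le _ _).trans <|
      Nat.add_le_add (by simp) (Finset.card_union_le _ _)
  have hcard' : (T.card : ℝ) ≤
      1 + ((T.filter (0 < ·)).card + (T.filter (· < 0)).card) := by exact_mod_cast hcard
  linarith

/-- The weight `max(|a|, 1)^{-1/2}` on the integers. -/
def sqrtWeight (a : ℤ) : ℝ := (√(max |(a : ℝ)| 1))⁻¹

theorem sqrtWeight_nonneg (a : ℤ) : 0 ≤ sqrtWeight a := by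
  unfold sqrtWeight; positivity

theorem sum_sqrtWeight_Icc_le (n : ℕ) :
    ∑ a ∈ Finset.Icc (-(n : ℤ)) n, sqrtWeight a ≤ 1 + 4 * √(n : ℝ) := by
  induction n with
  | zero => simp [sqrtWeight]
  | succ n ih =>
    have hins : Finset.Icc (-((n + 1 : ℕ) : ℤ)) ((n + 1 : ℕ) : ℤ) =
        insert ((n : ℤ) + 1) (insert (-((n : ℤ) + 1)) (Finset.Icc (-(n : ℤ)) n)) := by
      ext x
      simp only [Finset.mem_Icc, Finset.mem_insert]
      push_cast
      omega
    have hw : sqrtWeight ((n : ℤ) + 1) = (√((n : ℝ) + 1))⁻¹ := by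
      unfold sqrtWeight
      push_cast
      rw [abs_of_nonneg (by positivity), max_eq_left (by linarith [n.cast_nonneg (α := ℝ)])]
    have hw' : sqrtWeight (-((n : ℤ) + 1)) = (√((n : ℝ) + 1))⁻¹ := by
      rw [← hw]
      unfold sqrtWeight
      rw [Int.cast_neg, abs_neg]
    rw [hins, Finset.sum_insert (by simp; omega), Finset.sum_insert (by simp), hw, hw']
    push_cast
    have hs : 0 < √((n : ℝ) + 1) := by positivity
    have h1 : √((n : ℝ) + 1) ^ 2 = n + 1 := Real.sq_sqrt (by positivity)
    have h2 : √(n : ℝ) ^ 2 = n := Real.sq_sqrt (by positivity)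
    have hstep : (√((n : ℝ) + 1))⁻¹ ≤ 2 * (√((n : ℝ) + 1) - √(n : ℝ)) := by
      rw [inv_le_iff_one_le_mul₀ hs]
      nlinarith [sq_nonneg (√((n : ℝ) + 1) - √(n : ℝ))]
    linarith

theorem sum_sqrtWeight_le (T : Finset ℤ) (N : ℝ) (hN : 1 ≤ N) (hT : (T.card : ℝ) ≤ 3 * N) :
    ∑ a ∈ T, sqrtWeight a ≤ 8 * √N := by
  have hs : 1 ≤ √N := Real.one_le_sqrt.2 hN
  have hsq : √N * √N = N := Real.mul_self_sqrt (by linarith)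
  rw [← Finset.sum_filter_add_sum_filter_not T (fun a : ℤ => |(a : ℝ)| ≤ N)]
  have hsmall : ∑ a ∈ T with |((a : ℤ) : ℝ)| ≤ N, sqrtWeight a ≤ 5 * √N := by
    have hsub : T.filter (fun a : ℤ => |(a : ℝ)| ≤ N) ⊆
        Finset.Icc (-((⌊N⌋₊ : ℕ) : ℤ)) (⌊N⌋₊ : ℕ) := by
      intro a ha
      have ha := (Finset.mem_filter.1 ha).2
      have hn : a.natAbs ≤ ⌊N⌋₊ := Nat.le_floor (by rwa [Nat.cast_natAbs, Int.cast_abs])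
      rw [Finset.mem_Icc]
      omega
    have h := (Finset.sum_le_sum_of_subset_of_nonneg hsub
      fun a _ _ => sqrtWeight_nonneg a).trans (sum_sqrtWeight_Icc_le ⌊N⌋₊)
    have hfl : √((⌊N⌋₊ : ℕ) : ℝ) ≤ √N := Real.sqrt_le_sqrt (Nat.floor_le (by linarith))
    linarith
  have hlarge : ∑ a ∈ T with ¬ |((a : ℤ) : ℝ)| ≤ N, sqrtWeight a ≤ 3 * √N := by
    have hterm : ∀ a ∈ T.filter (fun a : ℤ => ¬ |(a : ℝ)| ≤ N), sqrtWeight a ≤ (√N)⁻¹ := by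
      intro a ha
      have ha := (Finset.mem_filter.1 ha).2
      unfold sqrtWeight
      exact inv_anti₀ (by linarith)
        (Real.sqrt_le_sqrt ((not_le.1 ha).le.trans (le_max_left _ _)))
    have h := Finset.sum_le_card_nsmul _ _ _ hterm
    rw [nsmul_eq_mul] at h
    have hc : ((T.filter (fun a : ℤ => ¬ |(a : ℝ)| ≤ N)).card : ℝ) ≤ 3 * N :=
      le_trans (by exact_mod_cast Finset.card_filter_le _ _) hT
    calc _ ≤ _ := h
      _ ≤ 3 * N * (√N)⁻¹ := by gcongr
      _ = 3 * √N := by rw [mul_inv_eq_iff_eq_mul₀ (by linarith), mul_assoc, hsq]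
  linarith

/-- The integers within distance `N` of `c`. -/
def intBall (c N : ℝ) : Finset ℤ := Finset.Icc ⌈c - N⌉ ⌊c + N⌋

theorem mem_intBall {c N : ℝ} {a : ℤ} : a ∈ intBall c N ↔ |(a : ℝ) - c| ≤ N := by
  rw [intBall, Finset.mem_Icc, Int.ceil_le, Int.le_floor, abs_le]
  constructor <;> rintro ⟨h, h'⟩ <;> constructor <;> linarith

theorem card_intBall_le (c N : ℝ) (hN : 1 ≤ N) : ((intBall c N).card : ℝ) ≤ 3 * N := by
  have h := card_le_of_forall_sub_le (intBall c N) (2 * N) (by linarith) fun x hx y hy => by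
    rw [mem_intBall, abs_le] at hx hy
    linarith
  linarith

/-- Integer points of the cube of half-side `N` about `c` lying in the shell `||m|² - B| ≤ l`. -/
def shellPoints {d : ℕ} (c : Fin d → ℝ) (N B l : ℝ) : Finset (Fin d → ℤ) :=
  (Fintype.piFinset fun i => intBall (c i) N).filter fun m => |∑ i, (m i : ℝ) ^ 2 - B| ≤ l

theorem sum_piFinset_weight_le {r : ℕ} (c : Fin (r + 2) → ℝ) (N : ℝ) (hN : 1 ≤ N) :
    ∑ m ∈ Fintype.piFinset fun i => intBall (c i) N, sqrtWeight (m 0) * sqrtWeight (m 1) ≤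
      64 * 3 ^ r * N ^ (r + 1) := by
  have hprod : ∀ m : Fin (r + 2) → ℤ, sqrtWeight (m 0) * sqrtWeight (m 1) =
      ∏ i, (Fin.cons sqrtWeight (Fin.cons sqrtWeight fun _ _ => 1) :
        Fin (r + 2) → ℤ → ℝ) i (m i) := by
    intro m
    simp [Fin.prod_univ_succ]
  simp_rw [hprod]
  rw [← Finset.prod_univ_sum (fun i => intBall (c i) N) (fun i a =>
    (Fin.cons sqrtWeight (Fin.cons sqrtWeight fun _ _ => 1) : Fin (r + 2) → ℤ → ℝ) i a)]
  rw [Fin.prod_univ_succ, Fin.prod_univ_succ]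
  simp only [Fin.cons_zero, Fin.cons_succ, Finset.sum_const, nsmul_eq_mul, mul_one]
  have hw : ∀ i, ∑ a ∈ intBall (c i) N, sqrtWeight a ≤ 8 * √N := fun i =>
    sum_sqrtWeight_le _ N hN (card_intBall_le _ N hN)
  have hw0 : ∀ i, 0 ≤ ∑ a ∈ intBall (c i) N, sqrtWeight a := fun i =>
    Finset.sum_nonneg fun a _ => sqrtWeight_nonneg a
  have hrest : ∏ i : Fin r, ((intBall (c i.succ.succ) N).card : ℝ) ≤ (3 * N) ^ r := by
    have h := Finset.prod_le_prod (s := Finset.univ)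
      (f := fun i : Fin r => ((intBall (c i.succ.succ) N).card : ℝ)) (g := fun _ => 3 * N)
      (fun i _ => by positivity) (fun i _ => card_intBall_le _ N hN)
    simpa using h
  have hsq : √N * √N = N := Real.mul_self_sqrt (by linarith)
  calc _ ≤ (8 * √N) * ((8 * √N) * (3 * N) ^ r) :=
        mul_le_mul (hw _) (mul_le_mul (hw _) hrest (by positivity) (by positivity))
          (mul_nonneg (hw0 _) (by positivity)) (by positivity)
    _ = 64 * 3 ^ r * (√N * √N) * N ^ r := by ring
    _ = 64 * 3 ^ r * N ^ (r + 1) := by rw [hsq]; ring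

theorem card_shellPoints_dominant_le {r : ℕ} (c : Fin (r + 3) → ℝ) (N B l : ℝ) (hN : 1 ≤ N)
    (hl : 0 ≤ l) (j : Fin (r + 3)) :
    (((shellPoints c N B l).filter fun m => ∀ i, |m i| ≤ |m j|).card : ℝ) ≤
      128 * 3 ^ r * (N ^ (r + 2) + l * N ^ (r + 1)) := by
  set S := (shellPoints c N B l).filter fun m => ∀ i, |m i| ≤ |m j| with hS
  set P := Fintype.piFinset fun i => intBall (c (j.succAbove i)) N with hP
  have hmaps : ∀ m ∈ S, j.removeNth m ∈ P := by
    intro m hm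
    rw [hS, Finset.mem_filter, shellPoints, Finset.mem_filter, Fintype.mem_piFinset] at hm
    exact Fintype.mem_piFinset.2 fun i => hm.1.1 _
  have hfiber : ∀ q ∈ P, ((S.filter fun m => j.removeNth m = q).card : ℝ) ≤
      3 + 2 * l * (sqrtWeight (q 0) * sqrtWeight (q 1)) := by
    intro q _
    have hinj : Set.InjOn (fun m : Fin (r + 3) → ℤ => m j)
        (S.filter fun m => j.removeNth m = q) := by
      intro m hm m' hm' h
      have hm := (Finset.mem_filter.1 (Finset.mem_coe.1 hm)).2
      have hm' := (Finset.mem_filter.1 (Finset.mem_coe.1 hm')).2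
      rw [← Fin.insertNth_self_removeNth j m, ← Fin.insertNth_self_removeNth j m', hm, hm']
      exact congrArg (fun x : ℤ => (j.insertNth x q : Fin (r + 3) → ℤ)) h
    rw [← Finset.card_image_of_injOn hinj]
    set μ := √(max |((q 0 : ℤ) : ℝ)| 1) * √(max |((q 1 : ℤ) : ℝ)| 1) with hμ
    have hμ0 : 0 < μ := by positivity
    have h := card_le_of_sq_near
      ((S.filter fun m => j.removeNth m = q).image fun m => m j) μ
      (B - ∑ i, (q i : ℝ) ^ 2) l hμ0 hl ?_ ?_
    · have hw : sqrtWeight (q 0) * sqrtWeight (q 1) = μ⁻¹ := by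
        rw [hμ, mul_inv]; rfl
      rw [hw]
      calc _ ≤ _ := h
        _ = _ := by rw [div_eq_mul_inv]; ring
    · intro x hx hx0
      obtain ⟨m, hm, rfl⟩ := Finset.mem_image.1 hx
      obtain ⟨hmS, rfl⟩ := Finset.mem_filter.1 hm
      have hdom := (Finset.mem_filter.1 hmS).2
      have h1 : (1 : ℝ) ≤ |(m j : ℝ)| := by exact_mod_cast Int.one_le_abs hx0
      have hle : ∀ i, √(max |((j.removeNth m i : ℤ) : ℝ)| 1) ≤ √|(m j : ℝ)| := fun i =>
        Real.sqrt_le_sqrt (max_le (by exact_mod_cast hdom (j.succAbove i)) h1)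
      calc μ ≤ √|(m j : ℝ)| * √|(m j : ℝ)| :=
            mul_le_mul (hle 0) (hle 1) (by positivity) (by positivity)
        _ = _ := Real.mul_self_sqrt (abs_nonneg _)
    · intro x hx
      obtain ⟨m, hm, rfl⟩ := Finset.mem_image.1 hx
      obtain ⟨hmS, rfl⟩ := Finset.mem_filter.1 hm
      have hsh := (Finset.mem_filter.1 (Finset.mem_filter.1 hmS).1).2
      rw [Fin.sum_univ_succAbove _ j] at hsh
      convert hsh using 2
      simp only [Fin.removeNth]
      ring
  have hcardP : (P.card : ℝ) ≤ (3 * N) ^ (r + 2) := by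
    rw [hP, Fintype.card_piFinset]
    push_cast
    have h := Finset.prod_le_prod (s := Finset.univ)
      (f := fun i : Fin (r + 2) => ((intBall (c (j.succAbove i)) N).card : ℝ))
      (g := fun _ => 3 * N) (fun i _ => by positivity) (fun i _ => card_intBall_le _ N hN)
    simpa using h
  have hsum := sum_piFinset_weight_le (fun i => c (j.succAbove i)) N hN
  rw [Finset.card_eq_sum_card_fiberwise (t := P) (f := fun m => j.removeNth m)
    fun m hm => hmaps m hm]
  push_cast
  calc _ ≤ ∑ q ∈ P, (3 + 2 * l * (sqrtWeight (q 0) * sqrtWeight (q 1))) :=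
        Finset.sum_le_sum hfiber
    _ = P.card * 3 + 2 * l * ∑ q ∈ P, sqrtWeight (q 0) * sqrtWeight (q 1) := by
        rw [Finset.sum_add_distrib, Finset.sum_const, nsmul_eq_mul, Finset.mul_sum]
    _ ≤ (3 * N) ^ (r + 2) * 3 + 2 * l * (64 * 3 ^ r * N ^ (r + 1)) := by gcongr
    _ = 27 * (3 ^ r * N ^ (r + 2)) + 128 * 3 ^ r * (l * N ^ (r + 1)) := by ring
    _ ≤ 128 * (3 ^ r * N ^ (r + 2)) + 128 * 3 ^ r * (l * N ^ (r + 1)) := by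
        gcongr; norm_num
    _ = _ := by ring

theorem card_shellPoints_le {r : ℕ} (c : Fin (r + 3) → ℝ) (N B l : ℝ) (hN : 1 ≤ N)
    (hl : 0 ≤ l) : ((shellPoints c N B l).card : ℝ) ≤
      (r + 3) * (128 * 3 ^ r * (N ^ (r + 2) + l * N ^ (r + 1))) := by
  have hsub : shellPoints c N B l ⊆ Finset.univ.biUnion fun j =>
      (shellPoints c N B l).filter fun m => ∀ i, |m i| ≤ |m j| := by
    intro m hm
    obtain ⟨j, -, hj⟩ := Finset.exists_max_image Finset.univ (fun i => |m i|)
      Finset.univ_nonempty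
    exact Finset.mem_biUnion.2 ⟨j, Finset.mem_univ _,
      Finset.mem_filter.2 ⟨hm, fun i => hj i (Finset.mem_univ _)⟩⟩
  have hcard := (Finset.card_le_card hsub).trans Finset.card_biUnion_le
  have hreal : ((shellPoints c N B l).card : ℝ) ≤ ∑ j,
      (((shellPoints c N B l).filter fun m => ∀ i, |m i| ≤ |m j|).card : ℝ) := by
    exact_mod_cast hcard
  refine hreal.trans ((Finset.sum_le_card_nsmul _ _ _ fun j _ =>
    card_shellPoints_dominant_le c N B l hN hl j).trans_eq ?_)
  simp

theorem ncard_pairs_le {d : ℕ} (L ε : ℝ) (hL : 0 < L) (k10 k20 k : EuclideanSpace ℝ (Fin d))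
    (β : ℝ) :
    Set.ncard {p : EuclideanSpace ℝ (Fin d) × EuclideanSpace ℝ (Fin d) |
        p.1 ∈ ZLat d L ∧ p.2 ∈ ZLat d L ∧ ‖p.1 - k10‖ ≤ 1 ∧ ‖p.2 - k20‖ ≤ 1 ∧
        p.1 + p.2 = k ∧ |‖p.1‖ ^ 2 + ‖p.2‖ ^ 2 - β| ≤ ε} ≤
      (shellPoints (fun i => L * (k10 i - k20 i)) (2 * L) (L ^ 2 * (2 * β - ‖k‖ ^ 2))
        (2 * L ^ 2 * ε)).card := by
  set f : EuclideanSpace ℝ (Fin d) × EuclideanSpace ℝ (Fin d) → Fin d → ℤ :=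
    fun p i => round (L * (p.1 i - p.2 i)) with hf
  have hcast : ∀ p : EuclideanSpace ℝ (Fin d) × EuclideanSpace ℝ (Fin d),
      p.1 ∈ ZLat d L → p.2 ∈ ZLat d L → ∀ i, (f p i : ℝ) = L * (p.1 i - p.2 i) := by
    intro p h1 h2 i
    obtain ⟨a, ha⟩ := h1 i
    obtain ⟨b, hb⟩ := h2 i
    have h : L * (p.1 i - p.2 i) = ((a - b : ℤ) : ℝ) := by
      rw [ha, hb]; push_cast; field_simp
    simp only [hf, h, round_intCast]
  rw [← Set.ncard_coe_finset]
  refine Set.ncard_le_ncard_of_injOn f ?_ ?_ (Finset.finite_toSet _)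
  · rintro p ⟨h1, h2, hk1, hk2, rfl, hβ⟩
    have hc := hcast p h1 h2
    refine Finset.mem_coe.2 (Finset.mem_filter.2 ⟨Fintype.mem_piFinset.2 fun i => ?_, ?_⟩)
    · rw [mem_intBall, hc]
      have e1 := (PiLp.norm_apply_le (p.1 - k10) i).trans hk1
      have e2 := (PiLp.norm_apply_le (p.2 - k20) i).trans hk2
      rw [Real.norm_eq_abs, PiLp.sub_apply, abs_le] at e1 e2
      rw [abs_le]
      constructor <;> nlinarith
    · have hsum : ∑ i, (f p i : ℝ) ^ 2 = L ^ 2 * ‖p.1 - p.2‖ ^ 2 := by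
        rw [EuclideanSpace.real_norm_sq_eq, Finset.mul_sum]
        exact Finset.sum_congr rfl fun i _ => by rw [hc, PiLp.sub_apply]; ring
      have hpar := parallelogram_law_with_norm ℝ p.1 p.2
      have heq : ∑ i, (f p i : ℝ) ^ 2 - L ^ 2 * (2 * β - ‖p.1 + p.2‖ ^ 2) =
          2 * L ^ 2 * (‖p.1‖ ^ 2 + ‖p.2‖ ^ 2 - β) := by
        rw [hsum]
        linear_combination L ^ 2 * hpar
      rw [heq, abs_mul, abs_of_pos (by positivity)]
      gcongr
  · rintro p ⟨h1, h2, -, -, hk, -⟩ q ⟨h1', h2', -, -, hk', -⟩ hpq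
    have hcoord : ∀ i, p.1 i = q.1 i ∧ p.2 i = q.2 i := by
      intro i
      have e : L * (p.1 i - p.2 i) = L * (q.1 i - q.2 i) := by
        rw [← hcast p h1 h2, ← hcast q h1' h2', hpq]
      have e1 := mul_left_cancel₀ hL.ne' e
      have e2 : p.1 i + p.2 i = q.1 i + q.2 i := by
        rw [← PiLp.add_apply, ← PiLp.add_apply, hk, hk']
      constructor <;> linarith
    exact Prod.ext (PiLp.ext fun i => (hcoord i).1) (PiLp.ext fun i => (hcoord i).2)

theorem statement5 (d : ℕ) (hd : 3 ≤ d) (γ : ℝ) (hγ : 0 < γ) (hγ' : γ < 1) :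
    ∃ η₀ : ℝ, 0 < η₀ ∧ ∀ η : ℝ, 0 < η → η ≤ η₀ →
    ∃ C : ℝ, 2 ≤ C ∧
    ∀ L δ : ℝ, C ≤ L → 0 < δ → δ < 1 → δ⁻¹ ≤ L ^ (η ^ 2) →
    ∀ (k10 k20 k : EuclideanSpace ℝ (Fin d)), k ∈ ZLat d L → ∀ β : ℝ,
      (Set.ncard {p : EuclideanSpace ℝ (Fin d) × EuclideanSpace ℝ (Fin d) |
          p.1 ∈ ZLat d L ∧ p.2 ∈ ZLat d L ∧ ‖p.1 - k10‖ ≤ 1 ∧ ‖p.2 - k20‖ ≤ 1 ∧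
          p.1 + p.2 = k ∧
          |‖p.1‖ ^ 2 + ‖p.2‖ ^ 2 - β| ≤ δ⁻¹ * L ^ (-(2 * γ))} : ℝ) ≤
        C * δ⁻¹ * L ^ ((d : ℝ) - γ - min γ (1 - γ)) := by
  obtain ⟨r, rfl⟩ := Nat.exists_eq_add_of_le' hd
  refine ⟨1, one_pos, fun η _ _ => ⟨(r + 3) * (128 * 3 ^ r) * 2 ^ (r + 3), ?_, ?_⟩⟩
  · have h3 : (1 : ℝ) ≤ 3 ^ r := one_le_pow₀ (by norm_num)
    have h2 : (1 : ℝ) ≤ 2 ^ (r + 3) := one_le_pow₀ (by norm_num)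
    have hr : (0 : ℝ) ≤ r := r.cast_nonneg
    have h4 : (2 : ℝ) ≤ (r + 3) * (128 * 3 ^ r) := by nlinarith
    nlinarith
  intro L δ hCL hδ hδ1 _ k10 k20 k _ β
  have hL : 1 ≤ L := by
    have h3 : (1 : ℝ) ≤ 3 ^ r := one_le_pow₀ (by norm_num)
    have h2 : (1 : ℝ) ≤ 2 ^ (r + 3) := one_le_pow₀ (by norm_num)
    have hr : (0 : ℝ) ≤ r := r.cast_nonneg
    have h4 : (2 : ℝ) ≤ (r + 3) * (128 * 3 ^ r) := by nlinarith
    nlinarith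
  have hL0 : 0 < L := by linarith
  set ε := δ⁻¹ * L ^ (-(2 * γ)) with hε
  have hε0 : 0 ≤ ε := by positivity
  set X := δ⁻¹ * L ^ (((r + 3 : ℕ) : ℝ) - γ - min γ (1 - γ)) with hX
  have hX1 : L ^ (r + 2) ≤ X := by
    have h : L ^ (r + 2) ≤ L ^ (((r + 3 : ℕ) : ℝ) - γ - min γ (1 - γ)) := by
      rw [← Real.rpow_natCast]
      refine Real.rpow_le_rpow_of_exponent_le hL ?_
      push_cast
      linarith [min_le_right γ (1 - γ)]
    exact h.trans (le_mul_of_one_le_left (by positivity) ((one_le_inv₀ hδ).2 hδ1.le))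
  have hX2 : L ^ (r + 3) * ε ≤ X := by
    have h : L ^ (r + 3) * L ^ (-(2 * γ)) ≤ L ^ (((r + 3 : ℕ) : ℝ) - γ - min γ (1 - γ)) := by
      rw [← Real.rpow_natCast, ← Real.rpow_add hL0]
      refine Real.rpow_le_rpow_of_exponent_le hL ?_
      linarith [min_le_left γ (1 - γ)]
    calc L ^ (r + 3) * ε = δ⁻¹ * (L ^ (r + 3) * L ^ (-(2 * γ))) := by rw [hε]; ring
      _ ≤ X := mul_le_mul_of_nonneg_left h (by positivity)
  have hcard := card_shellPoints_le (fun i => L * (k10 i - k20 i)) (2 * L)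
    (L ^ 2 * (2 * β - ‖k‖ ^ 2)) (2 * L ^ 2 * ε) (by linarith) (by positivity)
  calc _ ≤ _ := Nat.cast_le.2 (ncard_pairs_le L ε hL0 k10 k20 k β)
    _ ≤ _ := hcard
    _ = (r + 3) * (128 * 3 ^ r) * 2 ^ (r + 2) * (L ^ (r + 2) + L ^ (r + 3) * ε) := by ring
    _ ≤ (r + 3) * (128 * 3 ^ r) * 2 ^ (r + 2) * (X + X) :=
        mul_le_mul_of_nonneg_left (add_le_add hX1 hX2) (by positivity)
    _ = _ := by rw [hX]; ring
end
end

section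
/- Let k ∈ ℤ_L^d, β ∈ ℝ, and let R ∈ [L^{−1},1] satisfy R ≤ |k| ≤ 2R if R < 1, and |k| ≥ 1 if R = 1. Then the number of pairs (k₁,k₂) ∈ (ℤ_L^d)² with |k₁ − k₁⁰| ≤ 1, |k₂ − k₂⁰| ≤ 1, k₁ − k₂ = k, and | |k₁|² − |k₂|² − β | ≤ δ^{−1}L^{−2γ}, is at most C·( L^{d−1} + δ^{−1}·min( R^{−1}L^{d−2γ}, L^d ) ). -/
open scoped RealInnerProductSpace BigOperators

noncomputable section

/-- A finite set of integers of diameter at most `D` has at most `1 + D` elements. -/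
theorem Int.card_le_one_add_of_abs_sub_le (s : Finset ℤ) {D : ℝ} (hD : 0 ≤ D)
    (h : ∀ x ∈ s, ∀ y ∈ s, |(x : ℝ) - y| ≤ D) : (s.card : ℝ) ≤ 1 + D := by
  rcases s.eq_empty_or_nonempty with rfl | hs
  · simpa using by linarith
  have hsub : s ⊆ Finset.Icc (s.min' hs) (s.max' hs) := fun x hx =>
    Finset.mem_Icc.2 ⟨s.min'_le x hx, s.le_max' x hx⟩
  have hcard := Finset.card_le_card hsub
  rw [Int.card_Icc] at hcard
  have hle : s.min' hs ≤ s.max' hs := s.min'_le _ (s.max'_mem hs)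
  have hz : (s.card : ℤ) ≤ s.max' hs + 1 - s.min' hs := by omega
  have hr : (s.card : ℝ) ≤ s.max' hs + 1 - s.min' hs := by exact_mod_cast hz
  have hdiam := (le_abs_self _).trans (h _ (s.max'_mem hs) _ (s.min'_mem hs))
  linarith

/-- A finite set of integer vectors whose coordinate projections have diameter at most `E`, and
whose fibres in the direction `j` have diameter at most `D`, has at most
`(1 + D) (1 + E) ^ (d - 1)` elements. -/
theorem card_le_of_fiber_diam {d : ℕ} (A : Finset (Fin d → ℤ)) (j : Fin d) {D E : ℝ}
    (hD : 0 ≤ D) (hE : 0 ≤ E)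
    (hAE : ∀ m ∈ A, ∀ m' ∈ A, ∀ i, |(m i : ℝ) - m' i| ≤ E)
    (hAD : ∀ m ∈ A, ∀ m' ∈ A, (∀ i, i ≠ j → m i = m' i) → |(m j : ℝ) - m' j| ≤ D) :
    (A.card : ℝ) ≤ (1 + D) * (1 + E) ^ (d - 1) := by
  classical
  let t : Finset (Fin d → ℤ) :=
    Fintype.piFinset fun i => if i = j then {0} else A.image fun m => m i
  have hmaps : ∀ m ∈ A, Function.update m j 0 ∈ t := by
    intro m hm
    refine Fintype.mem_piFinset.2 fun i => ?_
    by_cases hij : i = j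
    · subst hij; simp
    · simpa [hij] using ⟨m, hm, rfl⟩
  have hfiber : ∀ b ∈ t, (A.filter fun m => Function.update m j 0 = b).card ≤ ⌊1 + D⌋₊ := by
    intro b _
    have heq : ∀ m ∈ A.filter (fun m => Function.update m j 0 = b),
        ∀ i, i ≠ j → m i = b i := by
      intro m hm i hi
      rw [← (Finset.mem_filter.1 hm).2, Function.update_of_ne hi]
    have hinj : Set.InjOn (fun m : Fin d → ℤ => m j)
        (A.filter fun m => Function.update m j 0 = b) := by
      intro m hm m' hm' hj
      funext i
      by_cases hij : i = j
      · subst hij; exact hj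
      · rw [heq m hm i hij, heq m' hm' i hij]
    rw [← Finset.card_image_of_injOn hinj]
    refine Nat.le_floor (Int.card_le_one_add_of_abs_sub_le _ hD ?_)
    intro x hx y hy
    obtain ⟨m, hm, rfl⟩ := Finset.mem_image.1 hx
    obtain ⟨m', hm', rfl⟩ := Finset.mem_image.1 hy
    exact hAD m (Finset.mem_filter.1 hm).1 m' (Finset.mem_filter.1 hm').1
      fun i hi => (heq m hm i hi).trans (heq m' hm' i hi).symm
  have hA := Finset.card_le_mul_card_image_of_maps_to hmaps _ hfiber
  have ht : (t.card : ℝ) ≤ (1 + E) ^ (d - 1) := by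
    rw [Fintype.card_piFinset, ← Finset.mul_prod_erase _ _ (Finset.mem_univ j)]
    push_cast
    rw [if_pos rfl, Finset.card_singleton, Nat.cast_one, one_mul]
    calc _ ≤ ∏ _i ∈ Finset.univ.erase j, (1 + E) := by
          refine Finset.prod_le_prod (fun _ _ => Nat.cast_nonneg _) fun i hi => ?_
          rw [if_neg (Finset.ne_of_mem_erase hi)]
          refine Int.card_le_one_add_of_abs_sub_le _ hE ?_
          intro x hx y hy
          obtain ⟨m, hm, rfl⟩ := Finset.mem_image.1 hx
          obtain ⟨m', hm', rfl⟩ := Finset.mem_image.1 hy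
          exact hAE m hm m' hm' i
      _ = _ := by simp
  calc (A.card : ℝ) ≤ (⌊1 + D⌋₊ : ℝ) * t.card := by exact_mod_cast hA
    _ ≤ _ := mul_le_mul (Nat.floor_le (by positivity)) ht (Nat.cast_nonneg _) (by positivity)

/-- Some coordinate of a vector in `ℝ^d` is at least its norm divided by `d`. -/
theorem EuclideanSpace.exists_norm_div_le_abs_apply {d : ℕ} (hd : 1 ≤ d)
    (k : EuclideanSpace ℝ (Fin d)) : ∃ j, ‖k‖ / d ≤ |k j| := by
  have hd' : (1 : ℝ) ≤ d := by exact_mod_cast hd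
  by_contra! h
  have : Nonempty (Fin d) := ⟨⟨0, hd⟩⟩
  have hsq : ‖k‖ ^ 2 < ∑ _j : Fin d, (‖k‖ / d) ^ 2 := by
    rw [EuclideanSpace.real_norm_sq_eq]
    refine Finset.sum_lt_sum_of_nonempty Finset.univ_nonempty fun j _ => ?_
    rw [← sq_abs (k j)]
    exact pow_lt_pow_left₀ (h j) (abs_nonneg _) two_ne_zero
  have hsum : ∑ _j : Fin d, (‖k‖ / d) ^ 2 = ‖k‖ ^ 2 / d := by
    simp only [Finset.sum_const, Finset.card_univ, Fintype.card_fin, nsmul_eq_mul]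
    field_simp
  rw [hsum] at hsq
  exact absurd hsq (not_lt.2 (div_le_self (sq_nonneg _) hd'))

/-- If `x` and `y` differ only in the coordinate `j` and the values of `|x|² - |x - k|²` and
`|y|² - |y - k|²` both lie within `T` of `β`, then `|k j| |x j - y j| ≤ T`. -/
theorem abs_mul_abs_sub_le_of_resonance {d : ℕ} {x y k : EuclideanSpace ℝ (Fin d)} {j : Fin d}
    {β T : ℝ} (hxy : ∀ i, i ≠ j → x i = y i)
    (hx : |‖x‖ ^ 2 - ‖x - k‖ ^ 2 - β| ≤ T) (hy : |‖y‖ ^ 2 - ‖y - k‖ ^ 2 - β| ≤ T) :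
    |k j| * |x j - y j| ≤ T := by
  have key : (‖x‖ ^ 2 - ‖x - k‖ ^ 2) - (‖y‖ ^ 2 - ‖y - k‖ ^ 2) = 2 * (k j * (x j - y j)) := by
    simp only [EuclideanSpace.real_norm_sq_eq, ← Finset.sum_sub_distrib]
    rw [Finset.sum_eq_single j]
    · simp only [PiLp.sub_apply]; ring
    · intro i _ hi
      simp only [PiLp.sub_apply, hxy i hi]; ring
    · simp
  rw [← abs_mul, abs_le]
  rw [abs_le] at hx hy
  constructor <;> linarith

theorem statement6 (d : ℕ) (hd : 3 ≤ d) (γ : ℝ) (hγ : 0 < γ) (hγ' : γ < 1) :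
    ∃ η₀ : ℝ, 0 < η₀ ∧ ∀ η : ℝ, 0 < η → η ≤ η₀ →
    ∃ C : ℝ, 2 ≤ C ∧
    ∀ L δ : ℝ, C ≤ L → 0 < δ → δ < 1 → δ⁻¹ ≤ L ^ (η ^ 2) →
    ∀ (k10 k20 k : EuclideanSpace ℝ (Fin d)), k ∈ ZLat d L → ∀ β R : ℝ,
      L⁻¹ ≤ R → R ≤ 1 →
      (R < 1 → R ≤ ‖k‖ ∧ ‖k‖ ≤ 2 * R) → (R = 1 → 1 ≤ ‖k‖) →
      (Set.ncard {p : EuclideanSpace ℝ (Fin d) × EuclideanSpace ℝ (Fin d) |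
          p.1 ∈ ZLat d L ∧ p.2 ∈ ZLat d L ∧ ‖p.1 - k10‖ ≤ 1 ∧ ‖p.2 - k20‖ ≤ 1 ∧
          p.1 - p.2 = k ∧
          |‖p.1‖ ^ 2 - ‖p.2‖ ^ 2 - β| ≤ δ⁻¹ * L ^ (-(2 * γ))} : ℝ) ≤
        C * (L ^ ((d : ℝ) - 1) + δ⁻¹ * min (R⁻¹ * L ^ ((d : ℝ) - 2 * γ)) (L ^ (d : ℝ))) := by
  classical
  refine ⟨1, one_pos, fun η _ _ => ⟨3 ^ d * d, ?_, ?_⟩⟩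
  · have h3 : (3 : ℝ) ≤ d := by exact_mod_cast hd
    have : (1 : ℝ) ≤ 3 ^ d := one_le_pow₀ (by norm_num)
    nlinarith
  intro L δ hCL hδ hδ1 _ k10 k20 k _ β R hLR hR1 hkR hkR1
  have h3 : (3 : ℝ) ≤ d := by exact_mod_cast hd
  have hL : 1 ≤ L := by
    have : (1 : ℝ) ≤ 3 ^ d := one_le_pow₀ (by norm_num)
    nlinarith
  have hL0 : 0 < L := by linarith
  have hR : 0 < R := (inv_pos.2 hL0).trans_le hLR
  have hk : R ≤ ‖k‖ := by
    rcases hR1.lt_or_eq with h | h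
    · exact (hkR h).1
    · exact h.le.trans (hkR1 h)
  obtain ⟨j, hj⟩ := EuclideanSpace.exists_norm_div_le_abs_apply (by omega : 1 ≤ d) k
  have hkj : R / d ≤ |k j| := (div_le_div_of_nonneg_right hk (by positivity)).trans hj
  set T : ℝ := δ⁻¹ * L ^ (-(2 * γ)) with hT
  have hT0 : 0 < T := by positivity
  let x : (Fin d → ℤ) → EuclideanSpace ℝ (Fin d) := fun m => WithLp.toLp 2 fun i => (m i : ℝ) / L
  have hx : ∀ m i, x m i = (m i : ℝ) / L := fun _ _ => rfl
  let A : Finset (Fin d → ℤ) :=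
    (Fintype.piFinset fun i => Finset.Icc ⌈L * (k10 i - 1)⌉ ⌊L * (k10 i + 1)⌋).filter
      fun m => |‖x m‖ ^ 2 - ‖x m - k‖ ^ 2 - β| ≤ T
  have hcount : Set.ncard {p : EuclideanSpace ℝ (Fin d) × EuclideanSpace ℝ (Fin d) |
      p.1 ∈ ZLat d L ∧ p.2 ∈ ZLat d L ∧ ‖p.1 - k10‖ ≤ 1 ∧ ‖p.2 - k20‖ ≤ 1 ∧
      p.1 - p.2 = k ∧ |‖p.1‖ ^ 2 - ‖p.2‖ ^ 2 - β| ≤ T} ≤ A.card := by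
    refine le_trans ?_ (Finset.card_image_le (s := A) (f := fun m => (x m, x m - k)))
    rw [← Set.ncard_coe_finset]
    refine Set.ncard_le_ncard ?_ (Finset.finite_toSet _)
    rintro ⟨p, q⟩ ⟨hp, -, hp1, -, hpq, hres⟩
    choose m hm using hp
    have hxp : x m = p := by ext i; rw [hx]; exact (hm i).symm
    have hq : x m - k = q := by rw [hxp, ← hpq]; simp
    refine Finset.mem_coe.2 (Finset.mem_image.2 ⟨m, Finset.mem_filter.2 ⟨?_, ?_⟩, ?_⟩)
    · refine Fintype.mem_piFinset.2 fun i => ?_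
      have hi : |p i - k10 i| ≤ 1 := (PiLp.norm_apply_le (p - k10) i).trans hp1
      have hmi : (m i : ℝ) = L * p i := by rw [← hxp, hx]; field_simp
      rw [abs_le] at hi
      rw [Finset.mem_Icc, Int.ceil_le, Int.le_floor, hmi]
      constructor <;> nlinarith
    · rw [hq, hxp]; exact hres
    · rw [hq, hxp]
  set D : ℝ := min (2 * L) (d * L * T / R)
  have hD : 0 ≤ D := le_min (by positivity) (by positivity)
  have hAE : ∀ m ∈ A, ∀ m' ∈ A, ∀ i, |(m i : ℝ) - m' i| ≤ 2 * L := by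
    intro m hm m' hm' i
    have h := Fintype.mem_piFinset.1 (Finset.mem_filter.1 hm).1 i
    have h' := Fintype.mem_piFinset.1 (Finset.mem_filter.1 hm').1 i
    rw [Finset.mem_Icc, Int.ceil_le, Int.le_floor] at h h'
    rw [abs_le]
    constructor <;> linarith
  have hAD : ∀ m ∈ A, ∀ m' ∈ A, (∀ i, i ≠ j → m i = m' i) → |(m j : ℝ) - m' j| ≤ D := by
    intro m hm m' hm' heq
    refine le_min (hAE m hm m' hm' j) ?_
    have h := abs_mul_abs_sub_le_of_resonance (j := j)
      (fun i hi => by rw [hx, hx, heq i hi]) (Finset.mem_filter.1 hm).2 (Finset.mem_filter.1 hm').2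
    rw [hx, hx, ← sub_div, abs_div, abs_of_pos hL0] at h
    have h' := (mul_le_mul_of_nonneg_right hkj (by positivity)).trans h
    rw [div_mul_div_comm, div_le_iff₀ (by positivity)] at h'
    rw [le_div_iff₀ hR]
    linarith
  have hA := card_le_of_fiber_diam A j hD (by positivity) hAE hAD
  have hLd1 : L ^ ((d : ℝ) - 1) = L ^ (d - 1) := by
    rw [← Real.rpow_natCast, Nat.cast_sub (by omega), Nat.cast_one]
  have hLd : L ^ (d : ℝ) = L ^ (d - 1) * L := by
    rw [Real.rpow_natCast, ← pow_succ, Nat.sub_add_cancel (by omega)]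
  have hLγ : L ^ ((d : ℝ) - 2 * γ) = L ^ (d - 1) * L * L ^ (-(2 * γ)) := by
    rw [← hLd, ← Real.rpow_add hL0, sub_eq_add_neg]
  have hδinv : 1 ≤ δ⁻¹ := (one_le_inv₀ hδ).2 hδ1.le
  have hDle : L ^ (d - 1) * D ≤
      d * (δ⁻¹ * min (R⁻¹ * L ^ ((d : ℝ) - 2 * γ)) (L ^ (d : ℝ))) := by
    rw [mul_min_of_nonneg _ _ (inv_pos.2 hδ).le, mul_min_of_nonneg _ _ (Nat.cast_nonneg d)]
    refine le_min ?_ ?_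
    · calc L ^ (d - 1) * D ≤ L ^ (d - 1) * (d * L * T / R) :=
            mul_le_mul_of_nonneg_left (min_le_right _ _) (by positivity)
        _ = _ := by rw [hLγ, hT]; ring
    · calc L ^ (d - 1) * D ≤ L ^ (d - 1) * (2 * L) :=
            mul_le_mul_of_nonneg_left (min_le_left _ _) (by positivity)
        _ = 2 * (1 * L ^ (d : ℝ)) := by rw [hLd]; ring
        _ ≤ _ := by gcongr; linarith
  set M : ℝ := δ⁻¹ * min (R⁻¹ * L ^ ((d : ℝ) - 2 * γ)) (L ^ (d : ℝ))
  rw [hLd1]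
  calc _ ≤ (A.card : ℝ) := by exact_mod_cast hcount
    _ ≤ (1 + D) * (1 + 2 * L) ^ (d - 1) := hA
    _ ≤ (1 + D) * (3 * L) ^ (d - 1) := by gcongr; linarith
    _ = 3 ^ (d - 1) * (L ^ (d - 1) + L ^ (d - 1) * D) := by rw [mul_pow]; ring
    _ ≤ 3 ^ (d - 1) * (d * L ^ (d - 1) + d * M) := by
        gcongr
        exact le_mul_of_one_le_left (by positivity) (by linarith)
    _ = 3 ^ (d - 1) * d * (L ^ (d - 1) + M) := by ring
    _ ≤ 3 ^ d * d * (L ^ (d - 1) + M) := by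
        gcongr
        · norm_num
        · omega
end
end

section
/- Let ε₁, ε₂ ∈ {±1}, k, k' ∈ ℤ_L^d and β, β' ∈ ℝ. Consider quadruples (k₁,k₂,k₃,k₄) ∈ (ℤ_L^d)⁴ with |k_j − k_j⁰| ≤ 1 for each j, satisfying either system (i): ε₁k₁ + ε₂k₂ − k₃ = k, |ε₁|k₁|² + ε₂|k₂|² − |k₃|² − β| ≤ δ^{−1}L^{−2γ}, k₃ + k₄ = k', and ||k₃|² + |k₄|² − β'| ≤ δ^{−1}L^{−2γ} (where ε₁, ε₂, −1 are not all equal); or system (ii): ε₁k₁ + ε₂k₂ + k₃ = k, |ε₁|k₁|² + ε₂|k₂|² + |k₃|² − β| ≤ δ^{−1}L^{−2γ}, −ε₁k₁ − ε₂k₂ + k₄ = k', and |−ε₁|k₁|² − ε₂|k₂|² + |k₄|² − β'| ≤ δ^{−1}L^{−2γ} (where ε₁, ε₂, +1 are not all equal). In either case the number of such quadruples is at most C·δ^{−2}·L^{2(d−γ)−γ₀}. -/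
open scoped RealInnerProductSpace BigOperators

noncomputable section

/-- Quadruples satisfying system (i). -/
def countSysI (d : ℕ) (L δ γ ε₁ ε₂ β β' : ℝ) (k k' k10 k20 k30 k40 : EuclideanSpace ℝ (Fin d)) :
    ℕ :=
  Set.ncard {q : EuclideanSpace ℝ (Fin d) × EuclideanSpace ℝ (Fin d) ×
      EuclideanSpace ℝ (Fin d) × EuclideanSpace ℝ (Fin d) |
    q.1 ∈ ZLat d L ∧ q.2.1 ∈ ZLat d L ∧ q.2.2.1 ∈ ZLat d L ∧ q.2.2.2 ∈ ZLat d L ∧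
    ‖q.1 - k10‖ ≤ 1 ∧ ‖q.2.1 - k20‖ ≤ 1 ∧ ‖q.2.2.1 - k30‖ ≤ 1 ∧ ‖q.2.2.2 - k40‖ ≤ 1 ∧
    ε₁ • q.1 + ε₂ • q.2.1 - q.2.2.1 = k ∧
    |ε₁ * ‖q.1‖ ^ 2 + ε₂ * ‖q.2.1‖ ^ 2 - ‖q.2.2.1‖ ^ 2 - β| ≤ δ⁻¹ * L ^ (-(2 * γ)) ∧
    q.2.2.1 + q.2.2.2 = k' ∧
    |‖q.2.2.1‖ ^ 2 + ‖q.2.2.2‖ ^ 2 - β'| ≤ δ⁻¹ * L ^ (-(2 * γ))}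

/-- Quadruples satisfying system (ii). -/
def countSysII (d : ℕ) (L δ γ ε₁ ε₂ β β' : ℝ) (k k' k10 k20 k30 k40 : EuclideanSpace ℝ (Fin d)) :
    ℕ :=
  Set.ncard {q : EuclideanSpace ℝ (Fin d) × EuclideanSpace ℝ (Fin d) ×
      EuclideanSpace ℝ (Fin d) × EuclideanSpace ℝ (Fin d) |
    q.1 ∈ ZLat d L ∧ q.2.1 ∈ ZLat d L ∧ q.2.2.1 ∈ ZLat d L ∧ q.2.2.2 ∈ ZLat d L ∧
    ‖q.1 - k10‖ ≤ 1 ∧ ‖q.2.1 - k20‖ ≤ 1 ∧ ‖q.2.2.1 - k30‖ ≤ 1 ∧ ‖q.2.2.2 - k40‖ ≤ 1 ∧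
    ε₁ • q.1 + ε₂ • q.2.1 + q.2.2.1 = k ∧
    |ε₁ * ‖q.1‖ ^ 2 + ε₂ * ‖q.2.1‖ ^ 2 + ‖q.2.2.1‖ ^ 2 - β| ≤ δ⁻¹ * L ^ (-(2 * γ)) ∧
    -(ε₁ • q.1) - ε₂ • q.2.1 + q.2.2.2 = k' ∧
    |-(ε₁ * ‖q.1‖ ^ 2) - ε₂ * ‖q.2.1‖ ^ 2 + ‖q.2.2.2‖ ^ 2 - β'| ≤ δ⁻¹ * L ^ (-(2 * γ))}

theorem card_le_of_sub_le (s : Finset ℤ) (N : ℕ) (h : ∀ a ∈ s, ∀ b ∈ s, a - b ≤ N) :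
    s.card ≤ N + 1 := by
  rcases s.eq_empty_or_nonempty with rfl | hs
  · simp
  · have hsub : s ⊆ Finset.Icc (s.min' hs) (s.min' hs + N) := by
      intro a ha
      have h1 := h a ha _ (s.min'_mem hs)
      have h2 := s.min'_le a ha
      rw [Finset.mem_Icc]
      omega
    have h3 := Finset.card_le_card hsub
    rw [Int.card_Icc] at h3
    omega

/-- A finite set of integer points whose projections have diameter at most `N` and whose fibres in
the direction `j` have diameter at most `W`. -/
theorem card_le_of_fiber_sub_le {d : ℕ} (s : Finset (Fin d → ℤ)) (j : Fin d) (N W : ℕ)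
    (hN : ∀ x ∈ s, ∀ y ∈ s, ∀ i, x i - y i ≤ N)
    (hW : ∀ x ∈ s, ∀ y ∈ s, (∀ i, i ≠ j → x i = y i) → x j - y j ≤ W) :
    s.card ≤ (W + 1) * (N + 1) ^ (d - 1) := by
  classical
  let f : (Fin d → ℤ) → ({i : Fin d // i ≠ j} → ℤ) := fun x i => x i
  have h1 : s.card ≤ (W + 1) * (s.image f).card := by
    refine Finset.card_le_mul_card_image s (W + 1) ?_
    intro b _
    have hinj : Set.InjOn (fun x : Fin d → ℤ => x j) (s.filter fun x => f x = b) := by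
      intro x hx y hy hxy
      simp only [Finset.coe_filter, Set.mem_ofPred_eq] at hx hy
      ext i
      by_cases hi : i = j
      · subst hi; exact hxy
      · exact congrFun (hx.2.trans hy.2.symm) ⟨i, hi⟩
    rw [← Finset.card_image_of_injOn hinj]
    refine card_le_of_sub_le _ _ ?_
    intro a ha c hc
    simp only [Finset.mem_image, Finset.mem_filter] at ha hc
    obtain ⟨x, ⟨hx, hxb⟩, rfl⟩ := ha
    obtain ⟨y, ⟨hy, hyb⟩, rfl⟩ := hc
    exact hW x hx y hy fun i hi => congrFun (hxb.trans hyb.symm) ⟨i, hi⟩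
  have h2 : (s.image f).card ≤ (N + 1) ^ (d - 1) := by
    have hsub : s.image f ⊆ Fintype.piFinset fun i : {i : Fin d // i ≠ j} =>
        s.image fun x => x i := by
      intro g hg
      obtain ⟨x, hx, rfl⟩ := Finset.mem_image.mp hg
      rw [Fintype.mem_piFinset]
      intro i
      exact Finset.mem_image_of_mem _ hx
    refine (Finset.card_le_card hsub).trans ?_
    rw [Fintype.card_piFinset]
    refine (Finset.prod_le_prod' (g := fun _ => N + 1) ?_).trans ?_
    · intro i _
      refine card_le_of_sub_le _ _ ?_
      intro a ha c hc
      obtain ⟨x, hx, rfl⟩ := Finset.mem_image.mp ha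
      obtain ⟨y, hy, rfl⟩ := Finset.mem_image.mp hc
      exact hN x hx y hy i
    · simp
  exact h1.trans (Nat.mul_le_mul_left _ h2)

/-- The integer coordinates of a point of the rescaled lattice. -/
def intCoords {d : ℕ} (L : ℝ) (x : EuclideanSpace ℝ (Fin d)) : Fin d → ℤ :=
  fun i => round (L * x i)

theorem intCoords_spec {d : ℕ} {L : ℝ} (hL : 0 < L) {x : EuclideanSpace ℝ (Fin d)}
    (hx : x ∈ ZLat d L) (i : Fin d) : (intCoords L x i : ℝ) = L * x i := by
  obtain ⟨m, hm⟩ := hx i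
  have : L * x i = m := by rw [hm]; field_simp
  simp [intCoords, this]

theorem intCoords_injOn {d : ℕ} {L : ℝ} (hL : 0 < L) : Set.InjOn (intCoords L) (ZLat d L) := by
  intro x hx y hy hxy
  ext i
  have h := intCoords_spec hL hx i
  rw [hxy, intCoords_spec hL hy i] at h
  exact (mul_left_cancel₀ hL.ne' h).symm

theorem abs_apply_le_norm {d : ℕ} (x : EuclideanSpace ℝ (Fin d)) (i : Fin d) : |x i| ≤ ‖x‖ := by
  simpa using PiLp.norm_apply_le x i

theorem ZLat_ball_finite {d : ℕ} {L : ℝ} (hL : 0 < L) (c : EuclideanSpace ℝ (Fin d)) :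
    {x | x ∈ ZLat d L ∧ ‖x - c‖ ≤ 1}.Finite := by
  refine Set.Finite.of_finite_image (f := intCoords L) ?_
    ((intCoords_injOn hL).mono fun x hx => hx.1)
  refine (Set.finite_Icc (fun i => ⌊L * (c i - 1)⌋) (fun i => ⌈L * (c i + 1)⌉)).subset ?_
  rintro _ ⟨x, ⟨hx, hxc⟩, rfl⟩
  have key : ∀ i, c i - 1 ≤ x i ∧ x i ≤ c i + 1 := by
    intro i
    have h := (abs_apply_le_norm (x - c) i).trans hxc
    rw [PiLp.sub_apply, abs_le] at h
    constructor <;> linarith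
  refine ⟨fun i => ?_, fun i => ?_⟩
  · have : (⌊L * (c i - 1)⌋ : ℝ) ≤ intCoords L x i := by
      rw [intCoords_spec hL hx]
      exact (Int.floor_le _).trans (mul_le_mul_of_nonneg_left (key i).1 hL.le)
    exact_mod_cast this
  · have : (intCoords L x i : ℝ) ≤ ⌈L * (c i + 1)⌉ := by
      rw [intCoords_spec hL hx]
      exact (mul_le_mul_of_nonneg_left (key i).2 hL.le).trans (Int.le_ceil _)
    exact_mod_cast this

theorem ncard_le_of_fiber {d : ℕ} {L : ℝ} (hL : 0 < L) {S : Set (EuclideanSpace ℝ (Fin d))}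
    (hS : S ⊆ ZLat d L) (hfin : S.Finite) (j : Fin d) {l w : ℝ} (hl : 0 ≤ l) (hw : 0 ≤ w)
    (h1 : ∀ x ∈ S, ∀ y ∈ S, ∀ i, x i - y i ≤ l)
    (h2 : ∀ x ∈ S, ∀ y ∈ S, (∀ i, i ≠ j → x i = y i) → x j - y j ≤ w) :
    (S.ncard : ℝ) ≤ (L * w + 1) * (L * l + 1) ^ (d - 1) := by
  classical
  have hinj : Set.InjOn (intCoords L) S := (intCoords_injOn hL).mono hS
  have hcard : S.ncard = (hfin.toFinset.image (intCoords L)).card := by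
    rw [Finset.card_image_of_injOn (by simpa using hinj), Set.ncard_eq_toFinset_card S hfin]
  have aux : ∀ x ∈ S, ∀ y ∈ S, ∀ i, ∀ v : ℝ, 0 ≤ v → x i - y i ≤ v →
      intCoords L x i - intCoords L y i ≤ ((⌊L * v⌋₊ : ℕ) : ℤ) := by
    intro x hx y hy i v hv h
    have h3 : ((intCoords L x i - intCoords L y i : ℤ) : ℝ) ≤ L * v := by
      push_cast
      rw [intCoords_spec hL (hS hx), intCoords_spec hL (hS hy), ← mul_sub]
      exact mul_le_mul_of_nonneg_left h hL.le
    rw [Int.natCast_floor_eq_floor (by positivity)]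
    exact Int.le_floor.mpr h3
  have hmain := card_le_of_fiber_sub_le (hfin.toFinset.image (intCoords L)) j ⌊L * l⌋₊ ⌊L * w⌋₊
    (by
      intro a ha b hb i
      simp only [Finset.mem_image, Set.Finite.mem_toFinset] at ha hb
      obtain ⟨x, hx, rfl⟩ := ha
      obtain ⟨y, hy, rfl⟩ := hb
      exact aux x hx y hy i l hl (h1 x hx y hy i))
    (by
      intro a ha b hb hab
      simp only [Finset.mem_image, Set.Finite.mem_toFinset] at ha hb
      obtain ⟨x, hx, rfl⟩ := ha
      obtain ⟨y, hy, rfl⟩ := hb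
      refine aux x hx y hy j w hw (h2 x hx y hy fun i hi => ?_)
      have h := intCoords_spec hL (hS hx) i
      rw [hab i hi, intCoords_spec hL (hS hy) i] at h
      exact (mul_left_cancel₀ hL.ne' h).symm)
  rw [hcard]
  have hmain' : ((hfin.toFinset.image (intCoords L)).card : ℝ) ≤
      ((⌊L * w⌋₊ : ℝ) + 1) * ((⌊L * l⌋₊ : ℝ) + 1) ^ (d - 1) := by exact_mod_cast hmain
  refine hmain'.trans ?_
  have f1 := Nat.floor_le (show 0 ≤ L * w by positivity)
  have f2 := Nat.floor_le (show 0 ≤ L * l by positivity)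
  gcongr

theorem ncard_le_of_box {d : ℕ} (hd : 1 ≤ d) {L : ℝ} (hL : 0 < L)
    {S : Set (EuclideanSpace ℝ (Fin d))} (hS : S ⊆ ZLat d L) (hfin : S.Finite) {l : ℝ}
    (hl : 0 ≤ l) (h1 : ∀ x ∈ S, ∀ y ∈ S, ∀ i, x i - y i ≤ l) :
    (S.ncard : ℝ) ≤ (L * l + 1) ^ d := by
  have h := ncard_le_of_fiber hL hS hfin ⟨0, hd⟩ hl hl h1 fun x hx y hy _ => h1 x hx y hy _
  rwa [← pow_succ', Nat.sub_add_cancel hd] at h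

theorem apply_sub_le_of_ball {d : ℕ} {c x y : EuclideanSpace ℝ (Fin d)} {r : ℝ}
    (hx : ‖x - c‖ ≤ r) (hy : ‖y - c‖ ≤ r) (i : Fin d) : x i - y i ≤ 2 * r := by
  have h1 := (abs_apply_le_norm (x - c) i).trans hx
  have h2 := (abs_apply_le_norm (y - c) i).trans hy
  rw [PiLp.sub_apply, abs_le] at h1 h2
  linarith

theorem sum_sq_sub_of_eq_off {d : ℕ} {x y c : EuclideanSpace ℝ (Fin d)} {j : Fin d}
    (h : ∀ i, i ≠ j → x i = y i) :
    ‖x - c‖ ^ 2 - ‖y - c‖ ^ 2 = (x j - c j) ^ 2 - (y j - c j) ^ 2 := by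
  rw [EuclideanSpace.real_norm_sq_eq, EuclideanSpace.real_norm_sq_eq, ← Finset.sum_sub_distrib]
  rw [Finset.sum_eq_single j]
  · simp
  · intro i _ hi
    simp [h i hi]
  · simp

/-- Lattice points in a thin spherical shell, localised to a unit ball. -/
theorem shell_count {d : ℕ} (hd : 2 ≤ d) {L T : ℝ} (hL : 1 ≤ L) (hT : 0 < T) (hT1 : T ≤ 1)
    (hLT : 1 ≤ L ^ 2 * T) (x₀ c : EuclideanSpace ℝ (Fin d)) (A : ℝ) :
    (Set.ncard {x | x ∈ ZLat d L ∧ ‖x - x₀‖ ≤ 1 ∧ |‖x - c‖ ^ 2 - A| ≤ T} : ℝ) ≤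
      (5 ^ d + 4 * d ^ 2 * 4 ^ d) * (L ^ (d - 1) + L ^ d * T) := by
  set S := {x | x ∈ ZLat d L ∧ ‖x - x₀‖ ≤ 1 ∧ |‖x - c‖ ^ 2 - A| ≤ T}
  have hL0 : 0 < L := by linarith
  have hd0 : (2 : ℝ) ≤ d := by exact_mod_cast hd
  have hSL : S ⊆ ZLat d L := fun x hx => hx.1
  have hSfin : S.Finite := (ZLat_ball_finite hL0 x₀).subset fun x hx => ⟨hx.1, hx.2.1⟩
  have hsT : 0 < √T := Real.sqrt_pos.mpr hT
  have hsT2 : √T ^ 2 = T := Real.sq_sqrt hT.le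
  have hLsT : 1 ≤ L * √T := by
    have : (1 : ℝ) ^ 2 ≤ (L * √T) ^ 2 := by rw [mul_pow, hsT2]; simpa using hLT
    exact le_of_sq_le_sq this (by positivity)
  rcases le_or_gt A (2 * T) with hA | hA
  · have hball : ∀ x ∈ S, ‖x - c‖ ≤ 2 * √T := by
      intro x hx
      have h := (abs_le.mp hx.2.2).2
      refine le_of_sq_le_sq ?_ (by positivity)
      rw [mul_pow, hsT2]; linarith
    have h := ncard_le_of_box (by omega) hL0 hSL hSfin (l := 2 * (2 * √T)) (by positivity)
      fun x hx y hy i => apply_sub_le_of_ball (hball x hx) (hball y hy) i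
    have h5 : (L * (2 * (2 * √T)) + 1) ^ d ≤ (5 * (L * √T)) ^ d := by
      gcongr; linarith
    have h6 : √T ^ d ≤ T := by
      have : √T ≤ 1 := Real.sqrt_le_one.mpr hT1
      calc √T ^ d ≤ √T ^ 2 := pow_le_pow_of_le_one hsT.le this hd
        _ = T := hsT2
    calc (S.ncard : ℝ) ≤ (5 * (L * √T)) ^ d := h.trans h5
      _ = 5 ^ d * (L ^ d * √T ^ d) := by rw [mul_pow, mul_pow]
      _ ≤ 5 ^ d * (L ^ d * T) := by gcongr
      _ ≤ (5 ^ d + 4 * d ^ 2 * 4 ^ d) * (L ^ (d - 1) + L ^ d * T) := by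
        gcongr
        · have : (0 : ℝ) ≤ 4 * d ^ 2 * 4 ^ d := by positivity
          linarith
        · have : (0 : ℝ) ≤ L ^ (d - 1) := by positivity
          linarith
  · have hA0 : 0 < A := by linarith
    have hsA : 0 < √A := Real.sqrt_pos.mpr hA0
    have hsA2 : √A ^ 2 = A := Real.sq_sqrt hA0.le
    set m := √A / (2 * d) with hm
    have hm0 : 0 < m := by positivity
    set ρ := min 1 √A with hρ
    have hρ0 : 0 < ρ := lt_min one_pos hsA
    have hLρ : 1 ≤ L * ρ := by
      rw [hρ, mul_min_of_nonneg _ _ hL0.le]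
      refine le_min (by linarith) (hLsT.trans ?_)
      have : √T ≤ √A := Real.sqrt_le_sqrt (by linarith)
      gcongr
    have hdiam : ∀ x ∈ S, ∀ y ∈ S, ∀ i, x i - y i ≤ 3 * ρ := by
      intro x hx y hy i
      rw [hρ, mul_min_of_nonneg _ _ (by norm_num : (0 : ℝ) ≤ 3)]
      refine le_min ?_ ?_
      · have := apply_sub_le_of_ball hx.2.1 hy.2.1 i
        linarith
      · have hb : ∀ z ∈ S, ‖z - c‖ ≤ 3 / 2 * √A := by
          intro z hz
          have h := (abs_le.mp hz.2.2).2
          refine le_of_sq_le_sq ?_ (by positivity)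
          rw [mul_pow, hsA2]; linarith
        have := apply_sub_le_of_ball (hb x hx) (hb y hy) i
        linarith
    let piece : Fin d × Bool → Set (EuclideanSpace ℝ (Fin d)) := fun p =>
      {x | x ∈ S ∧ if p.2 then m ≤ x p.1 - c p.1 else m ≤ c p.1 - x p.1}
    have hcover : S ⊆ ⋃ p ∈ (Finset.univ : Finset (Fin d × Bool)), piece p := by
      intro x hx
      have hex : ∃ j, m ≤ |x j - c j| := by
        by_contra! hcon
        have h1 : ‖x - c‖ ^ 2 ≤ d * m ^ 2 := by
          rw [EuclideanSpace.real_norm_sq_eq]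
          have : ∀ i ∈ (Finset.univ : Finset (Fin d)), (x - c) i ^ 2 ≤ m ^ 2 := by
            intro i _
            rw [PiLp.sub_apply, ← sq_abs]
            have := hcon i
            gcongr
          simpa using Finset.sum_le_sum this
        have h2 : (d : ℝ) * m ^ 2 ≤ A / 4 := by
          rw [hm, div_pow, hsA2]
          rw [mul_div_assoc', div_le_div_iff₀ (by positivity) (by positivity)]
          nlinarith [mul_pos hA0 (by positivity : (0 : ℝ) < d)]
        have h3 := (abs_le.mp hx.2.2).1
        linarith
      obtain ⟨j, hj⟩ := hex
      simp only [Finset.mem_univ, Set.iUnion_true, Set.mem_iUnion]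
      rcases le_abs.mp hj with h | h
      · exact ⟨(j, true), hx, by simpa using h⟩
      · exact ⟨(j, false), hx, by simpa using h⟩
    have hpiece : ∀ p, ((piece p).ncard : ℝ) ≤ (L * (T / m) + 1) * (L * (3 * ρ) + 1) ^ (d - 1) := by
      rintro ⟨j, b⟩
      refine ncard_le_of_fiber hL0 (fun x hx => hSL hx.1) (hSfin.subset fun x hx => hx.1) j
        (by positivity) (by positivity) (fun x hx y hy => hdiam x hx.1 y hy.1) ?_
      intro x hx y hy hxy
      have hsq := sum_sq_sub_of_eq_off (c := c) hxy
      have hx2 := abs_le.mp hx.1.2.2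
      have hy2 := abs_le.mp hy.1.2.2
      have hxm := hx.2
      have hym := hy.2
      rw [le_div_iff₀ hm0]
      by_contra! hcon
      have hpos : 0 < x j - y j := pos_of_mul_pos_left (hT.trans hcon) hm0.le
      cases b
      · simp only [Bool.false_eq_true, if_false] at hxm hym
        nlinarith
      · simp only [if_true] at hxm hym
        nlinarith
    have hsum : (S.ncard : ℝ) ≤
        (2 * d) * ((L * (T / m) + 1) * (L * (3 * ρ) + 1) ^ (d - 1)) := by
      have h1 : S.ncard ≤ ∑ p : Fin d × Bool, (piece p).ncard :=
        (Set.ncard_le_ncard hcover ((Finset.univ.finite_toSet).biUnion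
          fun p _ => hSfin.subset fun x hx => hx.1)).trans (Finset.set_ncard_biUnion_le _ _)
      have h2 : (S.ncard : ℝ) ≤ ∑ p : Fin d × Bool, ((piece p).ncard : ℝ) := by exact_mod_cast h1
      refine (h2.trans (Finset.sum_le_sum fun p _ => hpiece p)).trans ?_
      simp only [Finset.sum_const, Finset.card_univ, Fintype.card_prod, Fintype.card_fin,
        Fintype.card_bool, nsmul_eq_mul]
      push_cast
      linarith
    have hρd : ρ ^ (d - 1) ≤ √A := by
      calc ρ ^ (d - 1) ≤ ρ ^ 1 := pow_le_pow_of_le_one hρ0.le (min_le_left _ _) (by omega)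
        _ ≤ √A := by rw [pow_one]; exact min_le_right _ _
    have hρd1 : ρ ^ (d - 1) ≤ 1 := pow_le_one₀ hρ0.le (min_le_left _ _)
    have hpw : (L * (3 * ρ) + 1) ^ (d - 1) ≤ 4 ^ d * (L ^ (d - 1) * ρ ^ (d - 1)) := by
      calc (L * (3 * ρ) + 1) ^ (d - 1) ≤ (4 * (L * ρ)) ^ (d - 1) := by gcongr; linarith
        _ = 4 ^ (d - 1) * (L ^ (d - 1) * ρ ^ (d - 1)) := by rw [mul_pow, mul_pow]
        _ ≤ _ := by
          gcongr
          · norm_num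
          · omega
    have hLd : L ^ d = L ^ (d - 1) * L := by rw [← pow_succ, Nat.sub_add_cancel (by omega)]
    have hTm : T / m * ρ ^ (d - 1) ≤ 2 * d * T := by
      calc T / m * ρ ^ (d - 1) ≤ T / m * √A := by gcongr
        _ = 2 * d * T := by rw [hm]; field_simp
    calc (S.ncard : ℝ) ≤ (2 * d) * ((L * (T / m) + 1) * (4 ^ d * (L ^ (d - 1) * ρ ^ (d - 1)))) := by
          refine hsum.trans ?_
          gcongr
      _ = (2 * d * 4 ^ d) * (L ^ d * (T / m * ρ ^ (d - 1)) + L ^ (d - 1) * ρ ^ (d - 1)) := by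
          rw [hLd]; ring
      _ ≤ (2 * d * 4 ^ d) * (L ^ d * (2 * d * T) + L ^ (d - 1) * (2 * d)) := by
          have : ρ ^ (d - 1) ≤ 2 * d := by linarith
          gcongr
      _ = (4 * d ^ 2 * 4 ^ d) * (L ^ (d - 1) + L ^ d * T) := by ring
      _ ≤ _ := by
          gcongr
          have : (0 : ℝ) ≤ 5 ^ d := by positivity
          linarith

/-- Lattice points in a slab, localised to a unit ball. -/
theorem slab_count {d : ℕ} {L T μ : ℝ} (hL : 1 ≤ L) (hT : 0 < T) (hμ : 0 < μ)
    (x₀ q : EuclideanSpace ℝ (Fin d)) (j : Fin d) (hj : μ ≤ |q j|) (b : ℝ) :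
    (Set.ncard {x | x ∈ ZLat d L ∧ ‖x - x₀‖ ≤ 1 ∧ |2 * ⟪q, x⟫ - b| ≤ T} : ℝ) ≤
      (L * (T / μ) + 1) * (L * 2 + 1) ^ (d - 1) := by
  have hL0 : 0 < L := by linarith
  refine ncard_le_of_fiber hL0 (fun x hx => hx.1)
    ((ZLat_ball_finite hL0 x₀).subset fun x hx => ⟨hx.1, hx.2.1⟩) j
    (by norm_num) (by positivity) ?_ ?_
  · intro x hx y hy i
    simpa using apply_sub_le_of_ball hx.2.1 hy.2.1 i
  · intro x hx y hy hxy
    have hin : ⟪q, x⟫ - ⟪q, y⟫ = q j * (x j - y j) := by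
      rw [← inner_sub_right, PiLp.inner_apply, Finset.sum_eq_single j]
      · simp [mul_comm]
      · intro i _ hi
        simp [hxy i hi]
      · simp
    have h1 := abs_le.mp hx.2.2
    have h2 := abs_le.mp hy.2.2
    have h3 : |q j| * |x j - y j| ≤ T := by
      rw [← abs_mul, ← hin, abs_le]
      constructor <;> linarith
    rw [le_div_iff₀ hμ]
    calc (x j - y j) * μ ≤ |x j - y j| * |q j| :=
          mul_le_mul (le_abs_self _) hj hμ.le (abs_nonneg _)
      _ ≤ T := by rwa [mul_comm]

theorem ncard_le_mul_of_fibers {α β : Type*} {Q : Set α} {S : Set β} (hQ : Q.Finite)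
    (hS : S.Finite) (f : α → β) (hf : ∀ x ∈ Q, f x ∈ S) {a b : ℝ} (hb : 0 ≤ b)
    (hSa : (S.ncard : ℝ) ≤ a)
    (hfib : ∀ y ∈ S, (Set.ncard {x | x ∈ Q ∧ f x = y} : ℝ) ≤ b) :
    (Q.ncard : ℝ) ≤ a * b := by
  classical
  have h := Finset.card_eq_sum_card_fiberwise (s := hQ.toFinset) (t := hS.toFinset) (f := f)
    (by intro x hx; simpa using hf x (by simpa using hx))
  rw [Set.ncard_eq_toFinset_card Q hQ, h]
  push_cast
  calc ∑ y ∈ hS.toFinset, ((hQ.toFinset.filter fun x => f x = y).card : ℝ)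
      ≤ ∑ _y ∈ hS.toFinset, b := by
        refine Finset.sum_le_sum fun y hy => ?_
        refine le_trans (le_of_eq ?_) (hfib y (by simpa using hy))
        rw [← Set.ncard_coe_finset]
        congr 2
        ext x
        simp
    _ = S.ncard * b := by
        rw [Finset.sum_const, nsmul_eq_mul, Set.ncard_eq_toFinset_card S hS]
    _ ≤ a * b := by gcongr

theorem sq_norm_add_sq_norm_sub {d : ℕ} (x K : EuclideanSpace ℝ (Fin d)) :
    ‖x‖ ^ 2 + ‖K - x‖ ^ 2 = 2 * ‖x - (1 / 2 : ℝ) • K‖ ^ 2 + ‖K‖ ^ 2 / 2 := by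
  rw [norm_sub_sq_real, norm_sub_sq_real, norm_smul, inner_smul_right, real_inner_comm x K, mul_pow]
  norm_num
  ring

theorem sq_norm_sub_sq_norm_sub {d : ℕ} (x q : EuclideanSpace ℝ (Fin d)) :
    ‖x‖ ^ 2 - ‖x - q‖ ^ 2 = 2 * ⟪q, x⟫ - ‖q‖ ^ 2 := by
  rw [norm_sub_sq_real, real_inner_comm x q]
  ring

/-- Size constraints on the thickness `δ⁻¹ L^{-2γ}` and the resulting bound for shells. -/
theorem shell_count_rpow {d : ℕ} (hd : 2 ≤ d) {γ L δ : ℝ} (hγ : 0 < γ) (hγ' : γ < 1) (hL : 1 ≤ L)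
    (hδ : 0 < δ) (hδ1 : δ < 1) (hδL : δ⁻¹ * L ^ (-(2 * γ)) ≤ 1)
    (x₀ c : EuclideanSpace ℝ (Fin d)) (A : ℝ) :
    (Set.ncard {x | x ∈ ZLat d L ∧ ‖x - x₀‖ ≤ 1 ∧
        |‖x - c‖ ^ 2 - A| ≤ δ⁻¹ * L ^ (-(2 * γ))} : ℝ) ≤
      2 * (5 ^ d + 4 * d ^ 2 * 4 ^ d) * (δ⁻¹ * L ^ ((d : ℝ) - γ - min γ (1 - γ))) := by
  have hL0 : 0 < L := by linarith
  have hδi : 1 ≤ δ⁻¹ := (one_le_inv₀ hδ).mpr hδ1.le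
  have hLT : 1 ≤ L ^ 2 * (δ⁻¹ * L ^ (-(2 * γ))) := by
    have h1 : L ^ 2 * L ^ (-(2 * γ)) = L ^ (2 - 2 * γ) := by
      rw [← Real.rpow_natCast, ← Real.rpow_add hL0]; norm_num [sub_eq_add_neg]
    have h2 : 1 ≤ L ^ (2 - 2 * γ) := Real.one_le_rpow hL (by linarith)
    calc (1 : ℝ) ≤ δ⁻¹ * L ^ (2 - 2 * γ) := one_le_mul_of_one_le_of_one_le hδi h2
      _ = _ := by rw [← h1]; ring
  refine (shell_count hd hL (by positivity) hδL hLT x₀ c A).trans ?_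
  have e1 : L ^ (d - 1) ≤ δ⁻¹ * L ^ ((d : ℝ) - γ - min γ (1 - γ)) := by
    rw [← Real.rpow_natCast, Nat.cast_sub (by omega)]
    refine (Real.rpow_le_rpow_of_exponent_le hL ?_).trans
      (le_mul_of_one_le_left (by positivity) hδi)
    have := min_le_right γ (1 - γ)
    push_cast
    linarith
  have e2 : L ^ d * (δ⁻¹ * L ^ (-(2 * γ))) ≤ δ⁻¹ * L ^ ((d : ℝ) - γ - min γ (1 - γ)) := by
    rw [mul_left_comm, ← Real.rpow_natCast, ← Real.rpow_add hL0]
    have := min_le_left γ (1 - γ)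
    gcongr δ⁻¹ * ?_
    exact Real.rpow_le_rpow_of_exponent_le hL (by linarith)
  calc (5 ^ d + 4 * (d : ℝ) ^ 2 * 4 ^ d) * (L ^ (d - 1) + L ^ d * (δ⁻¹ * L ^ (-(2 * γ))))
      ≤ (5 ^ d + 4 * (d : ℝ) ^ 2 * 4 ^ d) * (δ⁻¹ * L ^ ((d : ℝ) - γ - min γ (1 - γ)) +
          δ⁻¹ * L ^ ((d : ℝ) - γ - min γ (1 - γ))) := by gcongr
    _ = _ := by ring

/-- The number of pairs with prescribed signed sum and nearly prescribed signed energy, when the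
signs agree or the prescribed sum is not too small. -/
theorem pair_count {d : ℕ} (hd : 2 ≤ d) {γ L δ : ℝ} (hγ : 0 < γ) (hγ' : γ < 1) (hL : 1 ≤ L)
    (hδ : 0 < δ) (hδ1 : δ < 1) (hδL : δ⁻¹ * L ^ (-(2 * γ)) ≤ 1) {ε₁ ε₂ : ℝ}
    (h₁ : ε₁ = 1 ∨ ε₁ = -1) (h₂ : ε₂ = 1 ∨ ε₂ = -1) (x₀ P : EuclideanSpace ℝ (Fin d)) (b : ℝ)
    (hP : ε₁ = ε₂ ∨ ∃ j, L ^ (-γ) ≤ |P j|) :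
    (Set.ncard {x | x ∈ ZLat d L ∧ ‖x - x₀‖ ≤ 1 ∧
        |ε₁ * ‖x‖ ^ 2 + ε₂ * ‖ε₂ • (P - ε₁ • x)‖ ^ 2 - b| ≤ δ⁻¹ * L ^ (-(2 * γ))} : ℝ) ≤
      2 * (5 ^ d + 4 * d ^ 2 * 4 ^ d) * (δ⁻¹ * L ^ ((d : ℝ) - γ)) := by
  have hL0 : 0 < L := by linarith
  have hδi : 1 ≤ δ⁻¹ := (one_le_inv₀ hδ).mpr hδ1.le
  set T := δ⁻¹ * L ^ (-(2 * γ)) with hT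
  have hT0 : 0 < T := by positivity
  have hfin : ∀ p : EuclideanSpace ℝ (Fin d) → Prop,
      {x | x ∈ ZLat d L ∧ ‖x - x₀‖ ≤ 1 ∧ p x}.Finite := fun p =>
    (ZLat_ball_finite hL0 x₀).subset fun x hx => ⟨hx.1, hx.2.1⟩
  have hsq₁ : ε₁ * ε₁ = 1 := by rcases h₁ with rfl | rfl <;> norm_num
  have habs₁ : |ε₁| = 1 := by rcases h₁ with rfl | rfl <;> norm_num
  have habs₂ : |ε₂| = 1 := by rcases h₂ with rfl | rfl <;> norm_num
  have hnorm : ∀ x : EuclideanSpace ℝ (Fin d), ‖ε₂ • (P - ε₁ • x)‖ = ‖ε₁ • P - x‖ := by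
    intro x
    have : P - ε₁ • x = ε₁ • (ε₁ • P - x) := by
      rw [smul_sub, smul_smul, hsq₁, one_smul]
    rw [this, norm_smul, norm_smul, Real.norm_eq_abs, Real.norm_eq_abs, habs₁, habs₂]
    ring
  by_cases hε : ε₁ = ε₂
  · subst hε
    have hsub : {x | x ∈ ZLat d L ∧ ‖x - x₀‖ ≤ 1 ∧
        |ε₁ * ‖x‖ ^ 2 + ε₁ * ‖ε₁ • (P - ε₁ • x)‖ ^ 2 - b| ≤ T} ⊆
        {x | x ∈ ZLat d L ∧ ‖x - x₀‖ ≤ 1 ∧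
          |‖x - (1 / 2 : ℝ) • (ε₁ • P)‖ ^ 2 - (ε₁ * b - ‖ε₁ • P‖ ^ 2 / 2) / 2| ≤ T} := by
      rintro x ⟨hx1, hx2, hx3⟩
      refine ⟨hx1, hx2, ?_⟩
      rw [hnorm] at hx3
      have h := sq_norm_add_sq_norm_sub x (ε₁ • P)
      have h4 : ‖x - (1 / 2 : ℝ) • (ε₁ • P)‖ ^ 2 - (ε₁ * b - ‖ε₁ • P‖ ^ 2 / 2) / 2 =
          ε₁ / 2 * (ε₁ * ‖x‖ ^ 2 + ε₁ * ‖ε₁ • P - x‖ ^ 2 - b) := by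
        linear_combination (-1 / 2) * h - (‖x‖ ^ 2 + ‖ε₁ • P - x‖ ^ 2) / 2 * hsq₁
      rw [h4, abs_mul, abs_div, habs₁, abs_two]
      linarith
    have h := shell_count_rpow hd hγ hγ' hL hδ hδ1 hδL x₀ ((1 / 2 : ℝ) • (ε₁ • P))
      ((ε₁ * b - ‖ε₁ • P‖ ^ 2 / 2) / 2)
    refine (Nat.cast_le.mpr (Set.ncard_le_ncard hsub (hfin _))).trans (h.trans ?_)
    have : 0 ≤ min γ (1 - γ) := le_min hγ.le (by linarith)
    gcongr _ * (δ⁻¹ * ?_)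
    exact Real.rpow_le_rpow_of_exponent_le hL (by linarith)
  · obtain ⟨j, hj⟩ := hP.resolve_left hε
    have hneg : ε₂ = -ε₁ := by
      rcases h₁ with rfl | rfl <;> rcases h₂ with rfl | rfl <;>
        first | exact absurd rfl hε | norm_num
    have hsub : {x | x ∈ ZLat d L ∧ ‖x - x₀‖ ≤ 1 ∧
        |ε₁ * ‖x‖ ^ 2 + ε₂ * ‖ε₂ • (P - ε₁ • x)‖ ^ 2 - b| ≤ T} ⊆
        {x | x ∈ ZLat d L ∧ ‖x - x₀‖ ≤ 1 ∧
          |2 * ⟪ε₁ • P, x⟫ - (‖ε₁ • P‖ ^ 2 + ε₁ * b)| ≤ T} := by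
      rintro x ⟨hx1, hx2, hx3⟩
      refine ⟨hx1, hx2, ?_⟩
      rw [hnorm, norm_sub_rev, hneg] at hx3
      have h := sq_norm_sub_sq_norm_sub x (ε₁ • P)
      have h4 : 2 * ⟪ε₁ • P, x⟫ - (‖ε₁ • P‖ ^ 2 + ε₁ * b) =
          ε₁ * (ε₁ * ‖x‖ ^ 2 + -ε₁ * ‖x - ε₁ • P‖ ^ 2 - b) := by
        linear_combination -h - (‖x‖ ^ 2 - ‖x - ε₁ • P‖ ^ 2) * hsq₁
      rw [h4, abs_mul, habs₁, one_mul]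
      exact hx3
    have hj' : L ^ (-γ) ≤ |(ε₁ • P) j| := by
      rw [PiLp.smul_apply, smul_eq_mul, abs_mul, habs₁, one_mul]
      exact hj
    have h := slab_count hL hT0 (by positivity) x₀ (ε₁ • P) j hj' (‖ε₁ • P‖ ^ 2 + ε₁ * b)
    refine (Nat.cast_le.mpr (Set.ncard_le_ncard hsub (hfin _))).trans (h.trans ?_)
    have hTμ : T / L ^ (-γ) = δ⁻¹ * L ^ (-γ) := by
      rw [hT, mul_div_assoc, ← Real.rpow_sub hL0]
      congr 2; ring
    have e1 : L * (T / L ^ (-γ)) + 1 ≤ 2 * (δ⁻¹ * L ^ (1 - γ)) := by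
      have h1 : L * L ^ (-γ) = L ^ (1 - γ) := by
        rw [sub_eq_add_neg, Real.rpow_add hL0, Real.rpow_one]
      have h2 : 1 ≤ δ⁻¹ * L ^ (1 - γ) :=
        one_le_mul_of_one_le_of_one_le hδi (Real.one_le_rpow hL (by linarith))
      rw [hTμ, mul_left_comm, h1]
      linarith
    have e2 : (L * 2 + 1) ^ (d - 1) ≤ 5 ^ d * L ^ (d - 1) := by
      calc (L * 2 + 1) ^ (d - 1) ≤ (5 * L) ^ (d - 1) := by gcongr; linarith
        _ = 5 ^ (d - 1) * L ^ (d - 1) := mul_pow _ _ _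
        _ ≤ _ := by
          gcongr
          · norm_num
          · omega
    have e3 : L ^ (1 - γ) * L ^ (d - 1) = L ^ ((d : ℝ) - γ) := by
      rw [← Real.rpow_natCast, Nat.cast_sub (by omega), ← Real.rpow_add hL0]
      congr 1; push_cast; ring
    calc (L * (T / L ^ (-γ)) + 1) * (L * 2 + 1) ^ (d - 1)
        ≤ 2 * (δ⁻¹ * L ^ (1 - γ)) * (5 ^ d * L ^ (d - 1)) := by gcongr
      _ = 2 * 5 ^ d * (δ⁻¹ * (L ^ (1 - γ) * L ^ (d - 1))) := by ring
      _ = 2 * 5 ^ d * (δ⁻¹ * L ^ ((d : ℝ) - γ)) := by rw [e3]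
      _ ≤ _ := by
        gcongr
        have : (0 : ℝ) ≤ 4 * d ^ 2 * 4 ^ d := by positivity
        linarith

/-- The common relaxation of the two systems: `k₃ + k₄` and `‖k₃‖² + ‖k₄‖²` are (nearly)
prescribed, and `ε₁ k₁ + ε₂ k₂` and its signed energy are (nearly) prescribed in terms of `k₃`. -/
def relaxedSys (d : ℕ) (L τ ε₁ ε₂ σ B : ℝ) (b : EuclideanSpace ℝ (Fin d) → ℝ)
    (k K k10 k20 k30 k40 : EuclideanSpace ℝ (Fin d)) :
    Set (EuclideanSpace ℝ (Fin d) × EuclideanSpace ℝ (Fin d) ×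
      EuclideanSpace ℝ (Fin d) × EuclideanSpace ℝ (Fin d)) :=
  {q | q.1 ∈ ZLat d L ∧ q.2.1 ∈ ZLat d L ∧ q.2.2.1 ∈ ZLat d L ∧ q.2.2.2 ∈ ZLat d L ∧
    ‖q.1 - k10‖ ≤ 1 ∧ ‖q.2.1 - k20‖ ≤ 1 ∧ ‖q.2.2.1 - k30‖ ≤ 1 ∧ ‖q.2.2.2 - k40‖ ≤ 1 ∧
    ε₁ • q.1 + ε₂ • q.2.1 = k + σ • q.2.2.1 ∧
    |ε₁ * ‖q.1‖ ^ 2 + ε₂ * ‖q.2.1‖ ^ 2 - b q.2.2.1| ≤ τ ∧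
    q.2.2.1 + q.2.2.2 = K ∧
    |‖q.2.2.1‖ ^ 2 + ‖q.2.2.2‖ ^ 2 - B| ≤ 2 * τ}

theorem relaxedSys_finite {d : ℕ} {L : ℝ} (hL : 0 < L) (τ ε₁ ε₂ σ B : ℝ)
    (b : EuclideanSpace ℝ (Fin d) → ℝ) (k K k10 k20 k30 k40 : EuclideanSpace ℝ (Fin d)) :
    (relaxedSys d L τ ε₁ ε₂ σ B b k K k10 k20 k30 k40).Finite := by
  refine ((ZLat_ball_finite hL k10).prod ((ZLat_ball_finite hL k20).prod
    ((ZLat_ball_finite hL k30).prod (ZLat_ball_finite hL k40)))).subset ?_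
  rintro ⟨x1, x2, x3, x4⟩ ⟨h1, h2, h3, h4, h5, h6, h7, h8, -⟩
  exact ⟨⟨h1, h5⟩, ⟨h2, h6⟩, ⟨h3, h7⟩, ⟨h4, h8⟩⟩

/-- A solution of the relaxed system is determined by `k₃` and `k₁`. -/
theorem relaxedSys_fiber_le {d : ℕ} {L : ℝ} (hL : 0 < L) {ε₁ ε₂ : ℝ}
    (h₂ : ε₂ = 1 ∨ ε₂ = -1) (τ σ B : ℝ)
    (b : EuclideanSpace ℝ (Fin d) → ℝ) (k K k10 k20 k30 k40 y : EuclideanSpace ℝ (Fin d)) :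
    Set.ncard {q | q ∈ relaxedSys d L τ ε₁ ε₂ σ B b k K k10 k20 k30 k40 ∧ q.2.2.1 = y} ≤
      Set.ncard {x | x ∈ ZLat d L ∧ ‖x - k10‖ ≤ 1 ∧
        |ε₁ * ‖x‖ ^ 2 + ε₂ * ‖ε₂ • (k + σ • y - ε₁ • x)‖ ^ 2 - b y| ≤ τ} := by
  have hsq₂ : ε₂ * ε₂ = 1 := by rcases h₂ with rfl | rfl <;> norm_num
  have hk2 : ∀ x1 x2 z : EuclideanSpace ℝ (Fin d), ε₁ • x1 + ε₂ • x2 = z →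
      x2 = ε₂ • (z - ε₁ • x1) := by
    rintro x1 x2 _ rfl
    rw [add_sub_cancel_left, smul_smul, hsq₂, one_smul]
  refine Set.ncard_le_ncard_of_injOn Prod.fst ?_ ?_
    ((ZLat_ball_finite hL k10).subset fun x hx => ⟨hx.1, hx.2.1⟩)
  · rintro ⟨x1, x2, x3, x4⟩ ⟨⟨h1, -, -, -, h5, -, -, -, h9, h10, -⟩, rfl⟩
    refine ⟨h1, h5, ?_⟩
    dsimp only at h9 h10 ⊢
    rwa [← hk2 _ _ _ h9]
  · rintro ⟨x1, x2, x3, x4⟩ ⟨⟨-, -, -, -, -, -, -, -, h9, -, h11, -⟩, h3⟩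
      ⟨y1, y2, y3, y4⟩ ⟨⟨-, -, -, -, -, -, -, -, g9, -, g11, -⟩, g3⟩ hxy
    dsimp only at h9 h11 h3 g9 g11 g3 hxy
    subst hxy
    have e3 : x3 = y3 := h3.trans g3.symm
    subst e3
    rw [hk2 _ _ _ h9, hk2 _ _ _ g9, eq_sub_of_add_eq' h11, eq_sub_of_add_eq' g11]

theorem relaxedSys_ncard_le {d : ℕ} (hd : 3 ≤ d) {γ L δ : ℝ} (hγ : 0 < γ) (hγ' : γ < 1)
    (hL : 1 ≤ L) (hδ : 0 < δ) (hδ1 : δ < 1) (hδL : δ⁻¹ * L ^ (-(2 * γ)) ≤ 1) {ε₁ ε₂ σ : ℝ}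
    (h₁ : ε₁ = 1 ∨ ε₁ = -1) (h₂ : ε₂ = 1 ∨ ε₂ = -1) (hσ : σ = 1 ∨ σ = -1) (B : ℝ)
    (b : EuclideanSpace ℝ (Fin d) → ℝ) (k K k10 k20 k30 k40 : EuclideanSpace ℝ (Fin d)) :
    (Set.ncard (relaxedSys d L (δ⁻¹ * L ^ (-(2 * γ))) ε₁ ε₂ σ B b k K k10 k20 k30 k40) : ℝ) ≤
      ((2 * (5 ^ d + 4 * d ^ 2 * 4 ^ d)) ^ 2 + 9 ^ d) * δ⁻¹ ^ 2 *
        L ^ (2 * ((d : ℝ) - γ) - min γ (1 - γ)) := by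
  have hL0 : 0 < L := by linarith
  have hδi : 1 ≤ δ⁻¹ := (one_le_inv₀ hδ).mpr hδ1.le
  have hd3 : (3 : ℝ) ≤ d := by exact_mod_cast hd
  set M : ℝ := 2 * (5 ^ d + 4 * d ^ 2 * 4 ^ d) with hM
  have hM0 : 0 ≤ M := by positivity
  set τ := δ⁻¹ * L ^ (-(2 * γ)) with hτ
  set Q := relaxedSys d L τ ε₁ ε₂ σ B b k K k10 k20 k30 k40
  have hQfin : Q.Finite := relaxedSys_finite hL0 _ _ _ _ _ _ _ _ _ _ _ _
  let far : EuclideanSpace ℝ (Fin d) → Prop := fun y => ∃ j, L ^ (-γ) ≤ |(k + σ • y) j|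
  have hsplit : Q ⊆ {q | q ∈ Q ∧ far q.2.2.1} ∪ {q | q ∈ Q ∧ ¬ far q.2.2.1} := by
    intro q hq
    by_cases h : far q.2.2.1
    · exact Or.inl ⟨hq, h⟩
    · exact Or.inr ⟨hq, h⟩
  have hfibfin : ∀ y, {q | q ∈ Q ∧ q.2.2.1 = y}.Finite := fun y => hQfin.subset fun q hq => hq.1
  have hfar : (Set.ncard {q | q ∈ Q ∧ far q.2.2.1} : ℝ) ≤
      M * (δ⁻¹ * L ^ ((d : ℝ) - γ - min γ (1 - γ))) * (M * (δ⁻¹ * L ^ ((d : ℝ) - γ))) := by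
    refine ncard_le_mul_of_fibers (hQfin.subset fun q hq => hq.1)
      (S := {x | (x ∈ ZLat d L ∧ ‖x - k30‖ ≤ 1 ∧
        |‖x - (1 / 2 : ℝ) • K‖ ^ 2 - (B - ‖K‖ ^ 2 / 2) / 2| ≤ τ) ∧ far x})
      ((ZLat_ball_finite hL0 k30).subset fun x hx => ⟨hx.1.1, hx.1.2.1⟩)
      (fun q => q.2.2.1) ?_ (by positivity) ?_ ?_
    · rintro ⟨x1, x2, x3, x4⟩ ⟨⟨-, -, h3, -, -, -, h7, -, -, -, h11, h12⟩, hf⟩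
      refine ⟨⟨h3, h7, ?_⟩, hf⟩
      dsimp only at h11 h12 ⊢
      rw [eq_sub_of_add_eq' h11, sq_norm_add_sq_norm_sub, abs_le] at h12
      rw [abs_le]
      constructor <;> linarith
    · refine le_trans ?_ (shell_count_rpow (by omega) hγ hγ' hL hδ hδ1 hδL k30
        ((1 / 2 : ℝ) • K) ((B - ‖K‖ ^ 2 / 2) / 2))
      refine Nat.cast_le.mpr (Set.ncard_le_ncard (fun x hx => hx.1) ?_)
      exact (ZLat_ball_finite hL0 k30).subset fun x hx => ⟨hx.1, hx.2.1⟩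
    · rintro y ⟨-, hy⟩
      refine le_trans (Nat.cast_le.mpr ?_) (pair_count (by omega) hγ hγ' hL hδ hδ1 hδL h₁ h₂ k10
        (k + σ • y) (b y) (Or.inr hy))
      have hsub : {q | (q ∈ Q ∧ far q.2.2.1) ∧ q.2.2.1 = y} ⊆ {q | q ∈ Q ∧ q.2.2.1 = y} :=
        fun q hq => ⟨hq.1.1, hq.2⟩
      exact (Set.ncard_le_ncard hsub (hfibfin y)).trans
        (relaxedSys_fiber_le hL0 h₂ τ σ B b k K k10 k20 k30 k40 y)
  have hnear : (Set.ncard {q | q ∈ Q ∧ ¬ far q.2.2.1} : ℝ) ≤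
      (3 * L ^ (1 - γ)) ^ d * (3 * L) ^ d := by
    refine ncard_le_mul_of_fibers (hQfin.subset fun q hq => hq.1)
      (S := {x | (x ∈ ZLat d L ∧ ‖x - k30‖ ≤ 1) ∧ ¬ far x})
      ((ZLat_ball_finite hL0 k30).subset fun x hx => hx.1)
      (fun q => q.2.2.1) ?_ (by positivity) ?_ ?_
    · rintro q ⟨⟨-, -, h3, -, -, -, h7, -⟩, hf⟩
      exact ⟨⟨h3, h7⟩, hf⟩
    · refine (ncard_le_of_box (l := 2 * L ^ (-γ)) (by omega) hL0 (fun x hx => hx.1.1)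
        ((ZLat_ball_finite hL0 k30).subset fun x hx => hx.1) (by positivity) ?_).trans ?_
      · rintro x ⟨-, hx⟩ y ⟨-, hy⟩ i
        simp only [far, not_exists, not_le] at hx hy
        have hx' := abs_lt.mp (hx i)
        have hy' := abs_lt.mp (hy i)
        simp only [PiLp.add_apply, PiLp.smul_apply, smul_eq_mul] at hx' hy'
        rcases hσ with rfl | rfl <;> linarith
      · have h1 : L * L ^ (-γ) = L ^ (1 - γ) := by
          rw [sub_eq_add_neg, Real.rpow_add hL0, Real.rpow_one]
        have h2 : 1 ≤ L ^ (1 - γ) := Real.one_le_rpow hL (by linarith)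
        gcongr
        rw [mul_left_comm, h1]
        linarith
    · rintro y -
      have hsub : {q | (q ∈ Q ∧ ¬ far q.2.2.1) ∧ q.2.2.1 = y} ⊆ {q | q ∈ Q ∧ q.2.2.1 = y} :=
        fun q hq => ⟨hq.1.1, hq.2⟩
      have hfib := (Set.ncard_le_ncard hsub (hfibfin y)).trans
        (relaxedSys_fiber_le hL0 h₂ τ σ B b k K k10 k20 k30 k40 y)
      refine (Nat.cast_le.mpr hfib).trans ?_
      refine (ncard_le_of_box (l := 2) (by omega) hL0 (fun x hx => hx.1)
        ((ZLat_ball_finite hL0 k10).subset fun x hx => ⟨hx.1, hx.2.1⟩) (by norm_num) ?_).trans ?_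
      · intro x hx y hy i
        simpa using apply_sub_le_of_ball hx.2.1 hy.2.1 i
      · gcongr
        linarith
  have hcard : (Q.ncard : ℝ) ≤ (Set.ncard {q | q ∈ Q ∧ far q.2.2.1} : ℝ) +
      (Set.ncard {q | q ∈ Q ∧ ¬ far q.2.2.1} : ℝ) := by
    have h := (Set.ncard_le_ncard hsplit ((hQfin.subset fun q hq => hq.1).union
      (hQfin.subset fun q hq => hq.1))).trans (Set.ncard_union_le _ _)
    exact_mod_cast h
  have efar : M * (δ⁻¹ * L ^ ((d : ℝ) - γ - min γ (1 - γ))) * (M * (δ⁻¹ * L ^ ((d : ℝ) - γ))) =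
      M ^ 2 * δ⁻¹ ^ 2 * L ^ (2 * ((d : ℝ) - γ) - min γ (1 - γ)) := by
    have : 2 * ((d : ℝ) - γ) - min γ (1 - γ) =
        ((d : ℝ) - γ - min γ (1 - γ)) + ((d : ℝ) - γ) := by ring
    rw [this, Real.rpow_add hL0]
    ring
  have enear : (3 * L ^ (1 - γ)) ^ d * (3 * L) ^ d ≤
      9 ^ d * δ⁻¹ ^ 2 * L ^ (2 * ((d : ℝ) - γ) - min γ (1 - γ)) := by
    have h1 : (3 * L ^ (1 - γ)) ^ d * (3 * L) ^ d = 9 ^ d * L ^ ((1 - γ) * d + d) := by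
      rw [mul_pow, mul_pow, Real.rpow_add hL0, Real.rpow_mul hL0.le, Real.rpow_natCast,
        Real.rpow_natCast, show (9 : ℝ) = 3 * 3 by norm_num, mul_pow]
      ring
    have h2 : L ^ ((1 - γ) * d + d) ≤ L ^ (2 * ((d : ℝ) - γ) - min γ (1 - γ)) := by
      refine Real.rpow_le_rpow_of_exponent_le hL ?_
      have := min_le_left γ (1 - γ)
      nlinarith
    have h3 : (1 : ℝ) ≤ δ⁻¹ ^ 2 := one_le_pow₀ hδi
    rw [h1, mul_assoc]
    gcongr
    exact h2.trans (le_mul_of_one_le_left (by positivity) h3)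
  calc (Q.ncard : ℝ) ≤ M ^ 2 * δ⁻¹ ^ 2 * L ^ (2 * ((d : ℝ) - γ) - min γ (1 - γ)) +
        9 ^ d * δ⁻¹ ^ 2 * L ^ (2 * ((d : ℝ) - γ) - min γ (1 - γ)) := by linarith
    _ = _ := by ring

theorem statement8 (d : ℕ) (hd : 3 ≤ d) (γ : ℝ) (hγ : 0 < γ) (hγ' : γ < 1) :
    ∃ η₀ : ℝ, 0 < η₀ ∧ ∀ η : ℝ, 0 < η → η ≤ η₀ →
    ∃ C : ℝ, 2 ≤ C ∧
    ∀ L δ : ℝ, C ≤ L → 0 < δ → δ < 1 → δ⁻¹ ≤ L ^ (η ^ 2) →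
    ∀ ε₁ ε₂ : ℝ, (ε₁ = 1 ∨ ε₁ = -1) → (ε₂ = 1 ∨ ε₂ = -1) →
    ∀ (k10 k20 k30 k40 k k' : EuclideanSpace ℝ (Fin d)), k ∈ ZLat d L → k' ∈ ZLat d L →
    ∀ β β' : ℝ,
      ((¬(ε₁ = ε₂ ∧ ε₂ = -1) →
          (countSysI d L δ γ ε₁ ε₂ β β' k k' k10 k20 k30 k40 : ℝ) ≤
            C * δ⁻¹ ^ 2 * L ^ (2 * ((d : ℝ) - γ) - min γ (1 - γ))) ∧
        (¬(ε₁ = ε₂ ∧ ε₂ = 1) →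
          (countSysII d L δ γ ε₁ ε₂ β β' k k' k10 k20 k30 k40 : ℝ) ≤
            C * δ⁻¹ ^ 2 * L ^ (2 * ((d : ℝ) - γ) - min γ (1 - γ)))) := by
  refine ⟨γ, hγ, fun η hη hηγ => ?_⟩
  refine ⟨(2 * (5 ^ d + 4 * d ^ 2 * 4 ^ d)) ^ 2 + 9 ^ d, ?_, ?_⟩
  · have h1 : (1 : ℝ) ≤ 9 ^ d := one_le_pow₀ (by norm_num)
    have h2 : (1 : ℝ) ≤ 5 ^ d := one_le_pow₀ (by norm_num)
    have h3 : (0 : ℝ) ≤ 4 * d ^ 2 * 4 ^ d := by positivity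
    nlinarith
  intro L δ hCL hδ hδ1 hδL ε₁ ε₂ h₁ h₂ k10 k20 k30 k40 k k' _ _ β β'
  have hL : 1 ≤ L := by
    have h1 : (1 : ℝ) ≤ 9 ^ d := one_le_pow₀ (by norm_num)
    have h2 : (0 : ℝ) ≤ (2 * (5 ^ d + 4 * d ^ 2 * 4 ^ d)) ^ 2 := by positivity
    linarith
  have hL0 : 0 < L := by linarith
  have hτ1 : δ⁻¹ * L ^ (-(2 * γ)) ≤ 1 := by
    calc δ⁻¹ * L ^ (-(2 * γ)) ≤ L ^ (η ^ 2) * L ^ (-(2 * γ)) := by gcongr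
      _ = L ^ (η ^ 2 - 2 * γ) := by rw [← Real.rpow_add hL0, sub_eq_add_neg]
      _ ≤ 1 := Real.rpow_le_one_of_one_le_of_nonpos hL (by nlinarith)
  have hτ0 : 0 < δ⁻¹ * L ^ (-(2 * γ)) := by positivity
  refine ⟨fun _ => ?_, fun _ => ?_⟩
  · refine le_trans (Nat.cast_le.mpr ?_) (relaxedSys_ncard_le hd hγ hγ' hL hδ hδ1 hτ1 h₁ h₂
      (Or.inl rfl) β' (fun x => β + ‖x‖ ^ 2) k k' k10 k20 k30 k40)
    refine Set.ncard_le_ncard ?_ (relaxedSys_finite hL0 _ _ _ _ _ _ _ _ _ _ _ _)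
    rintro ⟨x1, x2, x3, x4⟩ ⟨g1, g2, g3, g4, g5, g6, g7, g8, g9, g10, g11, g12⟩
    dsimp only at g9 g10 g11 g12
    refine ⟨g1, g2, g3, g4, g5, g6, g7, g8, ?_, ?_, g11, ?_⟩ <;> dsimp only
    · rw [← g9]; module
    · convert g10 using 2; ring
    · linarith
  · refine le_trans (Nat.cast_le.mpr ?_) (relaxedSys_ncard_le hd hγ hγ' hL hδ hδ1 hτ1 h₁ h₂
      (Or.inr rfl) (β + β') (fun x => β - ‖x‖ ^ 2) k (k + k') k10 k20 k30 k40)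
    refine Set.ncard_le_ncard ?_ (relaxedSys_finite hL0 _ _ _ _ _ _ _ _ _ _ _ _)
    rintro ⟨x1, x2, x3, x4⟩ ⟨g1, g2, g3, g4, g5, g6, g7, g8, g9, g10, g11, g12⟩
    dsimp only at g9 g10 g11 g12
    refine ⟨g1, g2, g3, g4, g5, g6, g7, g8, ?_, ?_, ?_, ?_⟩ <;> dsimp only
    · rw [← g9]; module
    · convert g10 using 2; ring
    · rw [← g9, ← g11]; module
    · rw [abs_le] at g10 g12 ⊢
      constructor <;> linarith
end
end
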